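/- arXiv:1505.01930 — 2 statements merged into one kernel-verified Lean document; each statement's English description precedes it below -/
import Mathlib

section
/- Let p, T > 0 and let u : ℝ² → ℝ be continuous on [0,p]×[−T,T], with all partial derivatives u_x, u_t, u_xx, u_tt existing and continuous on Ω⁺ = (0,p)×(0,T) and on Ω⁻ = (0,p)×(−T,0). Suppose: (i) u_tt(x,t) = u_xx(x,t) for all (x,t) ∈ Ω⁺ and u_t(x,t) = −u_xx(x,t) for all (x,t) ∈ Ω⁻; (ii) u(0,t) = u(p,t) = 0 for all t ∈ (−T,T); (iii) for each x ∈ (0,p) the one-sided limits as t → 0⁺ and t → 0⁻ of u(x,t), u_t(x,t) and u_tt(x,t) exist and coincide pairwise; (iv) for each t ∈ (−T,T)∖{0}, lim_{x→0⁺} x·u_x(x,t) = 0 and lim_{x→p⁻} (p−x)·u_x(x,t) = 0. Then u(x,t) = 0 for all (x,t) ∈ [0,p]×[−T,T]. -/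
open Set Filter Topology

/-- The defect of `u` on the characteristic rectangle with lowest vertex `(x, t)` and side
parameters `a`, `b`. -/
def charDefect (u : ℝ → ℝ → ℝ) (x t a b : ℝ) : ℝ :=
  u x t - u (x + a) (t + a) - u (x - b) (t + b) + u (x + a - b) (t + a + b)

/-- `u` is a classical solution of `u_tt = u_xx` in `(0,p) × (0,T)`, continuous up to the boundary,
with first derivatives `ux`, `ut` and common second derivative `w`. -/
structure IsWave (p T : ℝ) (u ux ut w : ℝ → ℝ → ℝ) : Prop where
  cont : ContinuousOn (fun q : ℝ × ℝ => u q.1 q.2) (Icc 0 p ×ˢ Icc 0 T)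
  hx : ∀ x ∈ Ioo 0 p, ∀ t ∈ Ioo 0 T, HasDerivAt (fun y => u y t) (ux x t) x
  hxx : ∀ x ∈ Ioo 0 p, ∀ t ∈ Ioo 0 T, HasDerivAt (fun y => ux y t) (w x t) x
  ht : ∀ x ∈ Ioo 0 p, ∀ t ∈ Ioo 0 T, HasDerivAt (fun s => u x s) (ut x t) t
  htt : ∀ x ∈ Ioo 0 p, ∀ t ∈ Ioo 0 T, HasDerivAt (fun s => ut x s) (w x t) t
  contx : ContinuousOn (fun q : ℝ × ℝ => ux q.1 q.2) (Ioo 0 p ×ˢ Ioo 0 T)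
  contt : ContinuousOn (fun q : ℝ × ℝ => ut q.1 q.2) (Ioo 0 p ×ˢ Ioo 0 T)
  contw : ContinuousOn (fun q : ℝ × ℝ => w q.1 q.2) (Ioo 0 p ×ˢ Ioo 0 T)

lemma abs_second_difference_le {f f' f'' : ℝ → ℝ} {c h A ε : ℝ} (hh : 0 ≤ h)
    (hf : ∀ y ∈ Icc (c - h) (c + h), HasDerivAt f (f' y) y)
    (hf' : ∀ y ∈ Icc (c - h) (c + h), HasDerivAt f' (f'' y) y)
    (hb : ∀ y ∈ Icc (c - h) (c + h), |f'' y - A| ≤ ε) :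
    |f (c + h) + f (c - h) - 2 * f c - A * h ^ 2| ≤ 2 * ε * h ^ 2 := by
  have hε : 0 ≤ ε := (abs_nonneg _).trans (hb c ⟨by linarith, by linarith⟩)
  have h1 : ∀ r ∈ Icc 0 h, |f' (c + r) - f' (c - r) - 2 * A * r| ≤ 2 * ε * h := by
    rintro r ⟨hr0, hrh⟩
    have := (convex_Icc (c - h) (c + h)).norm_image_sub_le_of_norm_hasDerivWithin_le
      (f := fun y => f' y - A * y) (f' := fun y => f'' y - A) (C := ε) (x := c - r) (y := c + r)
      (fun y hy => by
        have := ((hf' y hy).sub ((hasDerivAt_id y).const_mul A)).hasDerivWithinAt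
          (s := Icc (c - h) (c + h))
        convert! this using 1
        simp)
      (fun y hy => hb y hy) ⟨by linarith, by linarith⟩ ⟨by linarith, by linarith⟩
    rw [Real.norm_eq_abs, Real.norm_eq_abs] at this
    have e1 : f' (c + r) - A * (c + r) - (f' (c - r) - A * (c - r))
      = f' (c + r) - f' (c - r) - 2 * A * r := by ring
    have e2 : |c + r - (c - r)| = 2 * r := by
      rw [abs_of_nonneg] <;> linarith
    rw [e1, e2] at this
    nlinarith
  have h2 := norm_image_sub_le_of_norm_deriv_le_segment' (a := 0) (b := h)
    (f := fun r => f (c + r) + f (c - r) - A * r ^ 2)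
    (f' := fun r => f' (c + r) - f' (c - r) - 2 * A * r) (C := 2 * ε * h)
    (fun r hr => by
      obtain ⟨hr0, hrh⟩ := hr
      have d1 := (hf (c + r) ⟨by linarith, by linarith⟩).comp_const_add c r
      have d2 := (hf (c - r) ⟨by linarith, by linarith⟩).comp_const_sub c r
      have d3 := ((hasDerivAt_pow 2 r).const_mul A)
      have := ((d1.add d2).sub d3).hasDerivWithinAt (s := Icc 0 h)
      convert! this using 1
      simp; ring)
    (fun r hr => h1 r ⟨hr.1, hr.2.le⟩) h ⟨hh, le_rfl⟩
  rw [Real.norm_eq_abs] at h2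
  simp only [add_zero, sub_zero] at h2
  convert h2 using 1
  · congr 1; ring
  · ring

lemma charDefect_grid (u : ℝ → ℝ → ℝ) (x t δ : ℝ) (n m : ℕ) :
    charDefect u x t (n * δ) (m * δ) = ∑ i ∈ Finset.range n, ∑ j ∈ Finset.range m,
      charDefect u (x + i * δ - j * δ) (t + i * δ + j * δ) δ δ := by
  have row : ∀ x t : ℝ, charDefect u x t δ (m * δ) = ∑ j ∈ Finset.range m,
      charDefect u (x - j * δ) (t + j * δ) δ δ := by
    intro x t
    induction m with
    | zero => simp [charDefect]
    | succ m ih =>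
      rw [Finset.sum_range_succ, ← ih]
      simp only [charDefect]
      push_cast
      ring_nf
  induction n with
  | zero => simp [charDefect]
  | succ n ih =>
    rw [Finset.sum_range_succ, ← ih]
    have := row (x + n * δ) (t + n * δ)
    rw [← this]
    simp only [charDefect]
    push_cast
    ring_nf

namespace IsWave

variable {p T : ℝ} {u ux ut w : ℝ → ℝ → ℝ}

lemma abs_charDefect_le (hu : IsWave p T u ux ut w) {x t h ε A : ℝ} (hh : 0 ≤ h)
    (hx0 : 0 < x - h) (hxp : x + h < p) (ht0 : 0 < t) (htT : t + 2 * h < T)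
    (hw : ∀ y ∈ Icc (x - h) (x + h), ∀ s ∈ Icc t (t + 2 * h), |w y s - A| ≤ ε) :
    |charDefect u x t h h| ≤ 4 * ε * h ^ 2 := by
  have h1 := abs_second_difference_le (f := fun y => u y (t + h)) (f' := fun y => ux y (t + h))
    (f'' := fun y => w y (t + h)) (c := x) (A := A) (ε := ε) hh
    (fun y hy => hu.hx y ⟨by linarith [hy.1], by linarith [hy.2]⟩ _ ⟨by linarith, by linarith⟩)
    (fun y hy => hu.hxx y ⟨by linarith [hy.1], by linarith [hy.2]⟩ _ ⟨by linarith, by linarith⟩)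
    (fun y hy => hw y hy _ ⟨by linarith, by linarith⟩)
  have h2 := abs_second_difference_le (f := fun s => u x s) (f' := fun s => ut x s)
    (f'' := fun s => w x s) (c := t + h) (A := A) (ε := ε) hh
    (fun y hy => hu.ht x ⟨by linarith, by linarith⟩ _ ⟨by linarith [hy.1], by linarith [hy.2]⟩)
    (fun y hy => hu.htt x ⟨by linarith, by linarith⟩ _ ⟨by linarith [hy.1], by linarith [hy.2]⟩)
    (fun y hy => hw x ⟨by linarith, by linarith⟩ _ ⟨by linarith [hy.1], by linarith [hy.2]⟩)
  have e : charDefect u x t h h = (u x (t + h + h) + u x (t + h - h) - 2 * u x (t + h) - A * h ^ 2)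
      - (u (x + h) (t + h) + u (x - h) (t + h) - 2 * u x (t + h) - A * h ^ 2) := by
    simp only [charDefect]
    ring_nf
  rw [e]
  rw [abs_le] at *
  constructor <;> linarith [h1.1, h1.2, h2.1, h2.2]

lemma charDefect_eq_zero_of_interior (hu : IsWave p T u ux ut w) {x t a b : ℝ} (ha : 0 < a)
    (hb : 0 ≤ b) (hx0 : 0 < x - b) (hxp : x + a < p) (ht0 : 0 < t) (htT : t + a + b < T) :
    charDefect u x t a b = 0 := by
  set K := Icc (x - b) (x + a) ×ˢ Icc t (t + a + b) with hK
  have hKc : IsCompact K := isCompact_Icc.prod isCompact_Icc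
  have hKs : K ⊆ Ioo 0 p ×ˢ Ioo 0 T := by
    rintro ⟨y, s⟩ ⟨hy, hs⟩
    exact ⟨⟨by linarith [hy.1], by linarith [hy.2]⟩, ⟨by linarith [hs.1], by linarith [hs.2]⟩⟩
  have hKs' : Ioo 0 p ×ˢ Ioo 0 T ⊆ Icc 0 p ×ˢ Icc 0 T :=
    prod_mono Ioo_subset_Icc_self Ioo_subset_Icc_self
  have hunif := hKc.uniformContinuousOn_of_continuous (hu.contw.mono hKs)
  rw [Metric.uniformContinuousOn_iff_le] at hunif
  have hD : ContinuousOn (fun β => charDefect u x t a β) (Icc 0 b) := by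
    have hc : ∀ f : ℝ → ℝ × ℝ, Continuous f → (∀ β ∈ Icc 0 b, f β ∈ K) →
        ContinuousOn (fun β => u (f β).1 (f β).2) (Icc 0 b) := fun f hf hm =>
      (hu.cont.mono (hKs.trans hKs')).comp hf.continuousOn hm
    unfold charDefect
    refine ((ContinuousOn.sub (hc (fun _ => (x, t)) (by fun_prop) ?_)
      (hc (fun _ => (x + a, t + a)) (by fun_prop) ?_)).sub
      (hc (fun β => (x - β, t + β)) (by fun_prop) ?_)).add
      (hc (fun β => (x + a - β, t + a + β)) (by fun_prop) ?_) <;>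
    · rintro β ⟨h0, h1⟩
      refine ⟨⟨?_, ?_⟩, ⟨?_, ?_⟩⟩ <;> dsimp only <;> linarith
  have hδ : Tendsto (fun N : ℝ => a / N) atTop (𝓝 0) := tendsto_const_nhds.div_atTop tendsto_id
  set β : ℕ → ℝ := fun N => (⌊b / a * N⌋₊ : ℝ) * (a / N) with hβ
  have hβlim : Tendsto β atTop (𝓝 b) := by
    have := ((tendsto_nat_floor_mul_div_atTop (R := ℝ) (a := b / a) (by positivity)).comp
      tendsto_natCast_atTop_atTop).mul_const a
    rw [div_mul_cancel₀ _ ha.ne'] at this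
    refine this.congr fun N => ?_
    simp [hβ]; ring
  have hβmem : ∀ᶠ N in atTop, β N ∈ Icc 0 b := by
    filter_upwards [eventually_gt_atTop 0] with N hN
    have hN' : (0 : ℝ) < N := by exact_mod_cast hN
    refine ⟨by positivity, ?_⟩
    have := Nat.floor_le (a := b / a * N) (by positivity)
    calc β N ≤ (b / a * N) * (a / N) := by simp only [hβ]; gcongr
      _ = b := by field_simp
  have hlim : Tendsto (fun N => charDefect u x t a (β N)) atTop (𝓝 (charDefect u x t a b)) :=
    ((hD b ⟨hb, le_rfl⟩).tendsto).comp
      (tendsto_nhdsWithin_iff.2 ⟨hβlim, hβmem⟩)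
  have key : ∀ ε > 0, |charDefect u x t a b| ≤ 4 * ε * (a * b) := by
    intro ε hε
    obtain ⟨d, hd, hdK⟩ := hunif ε hε
    refine le_of_tendsto hlim.abs ?_
    have hsmall : ∀ᶠ N : ℕ in atTop, a / (N : ℝ) < d / 2 :=
      (hδ.comp tendsto_natCast_atTop_atTop).eventually (gt_mem_nhds (by positivity))
    filter_upwards [eventually_gt_atTop 0, hβmem, hsmall] with N hN hβN hs
    have hN' : (0 : ℝ) < N := by exact_mod_cast hN
    set δ := a / (N : ℝ) with hδdef
    have hδ0 : 0 < δ := by positivity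
    have hNδ : N * δ = a := by rw [hδdef]; field_simp
    set m := ⌊b / a * N⌋₊
    have hmδ : (m : ℝ) * δ = β N := rfl
    rw [← hmδ] at hβN
    rw [← hmδ, ← hNδ, charDefect_grid]
    have cell : ∀ i ∈ Finset.range N, ∀ j ∈ Finset.range m,
        |charDefect u (x + i * δ - j * δ) (t + i * δ + j * δ) δ δ| ≤ 4 * ε * δ ^ 2 := by
      intro i hi j hj
      have hi' : (i : ℝ) + 1 ≤ N := by exact_mod_cast Finset.mem_range.1 hi
      have hj' : (j : ℝ) + 1 ≤ m := by exact_mod_cast Finset.mem_range.1 hj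
      have hiδ : i * δ + δ ≤ a := by nlinarith
      have hjδ : j * δ + δ ≤ b := by nlinarith [hβN.2]
      have hi0 : 0 ≤ i * δ := by positivity
      have hj0 : 0 ≤ j * δ := by positivity
      refine hu.abs_charDefect_le (A := w (x + i * δ - j * δ) (t + i * δ + j * δ)) hδ0.le
        (by linarith) (by linarith) (by linarith) (by linarith) ?_
      intro y hy s hs'
      have := hdK (y, s) ⟨⟨by simp; linarith [hy.1], by simp; linarith [hy.2]⟩,
        ⟨by simp; linarith [hs'.1], by simp; linarith [hs'.2]⟩⟩
        (x + i * δ - j * δ, t + i * δ + j * δ)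
        ⟨⟨by simp; linarith, by simp; linarith⟩, ⟨by simp; linarith, by simp; linarith⟩⟩ ?_
      · simpa [Real.dist_eq] using this
      · rw [Prod.dist_eq]
        refine max_le ?_ ?_ <;> simp only [Real.dist_eq] <;> rw [abs_le] <;>
          constructor <;> linarith [hy.1, hy.2, hs'.1, hs'.2]
    calc |∑ i ∈ Finset.range N, ∑ j ∈ Finset.range m,
          charDefect u (x + i * δ - j * δ) (t + i * δ + j * δ) δ δ|
        ≤ ∑ i ∈ Finset.range N, ∑ j ∈ Finset.range m, 4 * ε * δ ^ 2 := by
          refine (Finset.abs_sum_le_sum_abs _ _).trans (Finset.sum_le_sum fun i hi => ?_)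
          exact (Finset.abs_sum_le_sum_abs _ _).trans (Finset.sum_le_sum fun j hj => cell i hi j hj)
      _ = 4 * ε * ((N * δ) * (m * δ)) := by simp; ring
      _ ≤ 4 * ε * (N * δ * b) := by gcongr; exact hβN.2
  have hle : |charDefect u x t a b| ≤ 0 := by
    refine le_of_forall_pos_le_add fun ε hε => ?_
    have hab : 0 ≤ a * b := by positivity
    have := key (ε / (4 * (a * b + 1))) (by positivity)
    refine this.trans ?_
    rw [zero_add]
    have : 4 * (ε / (4 * (a * b + 1))) * (a * b) = ε * ((a * b) / (a * b + 1)) := by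
      field_simp
    rw [this]
    have : (a * b) / (a * b + 1) ≤ 1 := by rw [div_le_one (by positivity)]; linarith
    nlinarith
  exact abs_nonpos_iff.1 hle

/-- The characteristic parallelogram identity on the closed rectangle. -/
lemma charDefect_eq_zero (hu : IsWave p T u ux ut w) (hp : 0 < p) (hT : 0 < T) {x t a b : ℝ}
    (ha : 0 < a) (hb : 0 < b) (hx0 : 0 ≤ x - b) (hxp : x + a ≤ p) (ht0 : 0 ≤ t)
    (htT : t + a + b ≤ T) :
    charDefect u x t a b = 0 := by
  let X : ℝ → ℝ → ℝ := fun y e => p / 2 + (1 - e) * (y - p / 2)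
  let S : ℝ → ℝ → ℝ := fun s e => T / 2 + (1 - e) * (s - T / 2)
  have hc : ∀ y ∈ Icc 0 p, ∀ s ∈ Icc 0 T,
      Tendsto (fun e => u (X y e) (S s e)) (𝓝[Ioo 0 1] 0) (𝓝 (u y s)) := by
    intro y hy s hs
    have h1 := hu.cont (y, s) ⟨hy, hs⟩
    have h2 : Tendsto (fun e => (X y e, S s e)) (𝓝[Ioo 0 1] 0)
        (𝓝[Icc 0 p ×ˢ Icc 0 T] (y, s)) := by
      refine tendsto_nhdsWithin_iff.2 ⟨?_, ?_⟩
      · have : Continuous fun e => (X y e, S s e) := by fun_prop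
        have := (this.tendsto 0).mono_left (nhdsWithin_le_nhds (s := Ioo 0 1))
        simpa [X, S] using this
      · filter_upwards [self_mem_nhdsWithin] with e he
        obtain ⟨he0, he1⟩ := he
        obtain ⟨hy0, hy1⟩ := hy
        obtain ⟨hs0, hs1⟩ := hs
        refine ⟨⟨?_, ?_⟩, ⟨?_, ?_⟩⟩ <;> simp only [X, S] <;> nlinarith
    exact h1.tendsto.comp h2
  have hlim : Tendsto (fun e => charDefect u (X x e) (S t e) ((1 - e) * a) ((1 - e) * b))
      (𝓝[Ioo 0 1] 0) (𝓝 (charDefect u x t a b)) := by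
    have := (((hc x ⟨by linarith, by linarith⟩ t ⟨by linarith, by linarith⟩).sub
      (hc (x + a) ⟨by linarith, by linarith⟩ (t + a) ⟨by linarith, by linarith⟩)).sub
      (hc (x - b) ⟨by linarith, by linarith⟩ (t + b) ⟨by linarith, by linarith⟩)).add
      (hc (x + a - b) ⟨by linarith, by linarith⟩ (t + a + b) ⟨by linarith, by linarith⟩)
    refine this.congr fun e => ?_
    simp only [charDefect, X, S]
    ring_nf
  have hzero : ∀ᶠ e in 𝓝[Ioo (0 : ℝ) 1] 0,
      charDefect u (X x e) (S t e) ((1 - e) * a) ((1 - e) * b) = 0 := by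
    filter_upwards [self_mem_nhdsWithin] with e he
    obtain ⟨he0, he1⟩ := he
    refine hu.charDefect_eq_zero_of_interior (by nlinarith) (by nlinarith) ?_ ?_ ?_ ?_ <;>
      simp only [X, S] <;> nlinarith
  have : (𝓝[Ioo (0 : ℝ) 1] 0).NeBot := by
    rw [← mem_closure_iff_nhdsWithin_neBot, closure_Ioo (by norm_num)]
    simp
  exact tendsto_nhds_unique (hlim.congr' hzero) tendsto_const_nhds

lemma reflect (hu : IsWave p T u ux ut w) :
    IsWave p T (fun x t => u (p - x) t) (fun x t => -ux (p - x) t) (fun x t => ut (p - x) t)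
      (fun x t => w (p - x) t) := by
  have hm : ∀ x ∈ Ioo 0 p, p - x ∈ Ioo 0 p := fun x hx => ⟨by linarith [hx.2], by linarith [hx.1]⟩
  have hm' : ∀ x ∈ Icc 0 p, p - x ∈ Icc 0 p := fun x hx => ⟨by linarith [hx.2], by linarith [hx.1]⟩
  have hcomp : ∀ f : ℝ → ℝ → ℝ,
      ContinuousOn (fun q : ℝ × ℝ => f q.1 q.2) (Ioo 0 p ×ˢ Ioo 0 T) →
      ContinuousOn (fun q : ℝ × ℝ => f (p - q.1) q.2) (Ioo 0 p ×ˢ Ioo 0 T) := fun f hf =>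
    hf.comp (f := fun q : ℝ × ℝ => (p - q.1, q.2)) (by fun_prop) fun q hq => ⟨hm _ hq.1, hq.2⟩
  exact
    { cont := hu.cont.comp (f := fun q : ℝ × ℝ => (p - q.1, q.2)) (by fun_prop)
        fun q hq => ⟨hm' _ hq.1, hq.2⟩
      hx := fun x hx t ht => (hu.hx _ (hm x hx) t ht).comp_const_sub p x
      hxx := fun x hx t ht => by
        simpa using! ((hu.hxx _ (hm x hx) t ht).comp_const_sub p x).neg
      ht := fun x hx t ht => hu.ht _ (hm x hx) t ht
      htt := fun x hx t ht => hu.htt _ (hm x hx) t ht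
      contx := (hcomp ux hu.contx).neg
      contt := hcomp ut hu.contt
      contw := hcomp w hu.contw }

lemma continuousAt_w (hu : IsWave p T u ux ut w) {x t : ℝ} (hx : x ∈ Ioo 0 p) (ht : t ∈ Ioo 0 T) :
    ContinuousAt (fun q : ℝ × ℝ => w q.1 q.2) (x, t) :=
  hu.contw.continuousAt ((isOpen_Ioo.prod isOpen_Ioo).mem_nhds ⟨hx, ht⟩)

/-- Interior `C²` regularity of the initial profile, with trace of `w` at `t = 0`. -/
lemma exists_local_second_deriv (hu : IsWave p T u ux ut w) (hT : 0 < T) {x₀ : ℝ}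
    (hx₀ : x₀ ∈ Ioo 0 p) :
    ∃ F' F'' : ℝ → ℝ, ContinuousAt F'' x₀ ∧
      (∀ᶠ x in 𝓝 x₀, HasDerivAt (fun y => u y 0) (F' x) x ∧ HasDerivAt F' (F'' x) x) ∧
      Tendsto (fun r => w x₀ r) (𝓝[>] 0) (𝓝 (F'' x₀)) := by
  obtain ⟨h0, hp0⟩ := hx₀
  obtain ⟨h, hh, hhx, hhp, hhT⟩ : ∃ h, 0 < h ∧ h < x₀ ∧ h < p - x₀ ∧ 2 * h < T := by
    obtain ⟨h, hh, hlt⟩ := exists_between (lt_min (lt_min h0 (sub_pos.2 hp0)) (half_pos hT))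
    rw [lt_min_iff, lt_min_iff] at hlt
    exact ⟨h, hh, hlt.1.1, hlt.1.2, by linarith [hlt.2]⟩
  have hev : ∀ᶠ x in 𝓝 x₀, h < x ∧ x < p - h :=
    (lt_mem_nhds hhx).and (gt_mem_nhds (by linarith))
  have hrep : ∀ x, h < x → x < p - h → ∀ r, 0 ≤ r → r + 2 * h < T →
      u x r = u (x + h) (r + h) + u (x - h) (r + h) - u x (r + 2 * h) := by
    intro x h1 h2 r hr hrT
    have := hu.charDefect_eq_zero (h0.trans hp0) hT (x := x) (t := r) (a := h) (b := h)
      hh hh (by linarith) (by linarith) hr (by linarith)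
    simp only [charDefect] at this
    rw [show x + h - h = x by ring, show r + h + h = r + 2 * h by ring] at this
    linarith
  have hder : ∀ r, 0 ≤ r → r + 2 * h < T → ∀ x, h < x → x < p - h →
      HasDerivAt (fun y => u (y + h) (r + h) + u (y - h) (r + h) - u y (r + 2 * h))
        (ux (x + h) (r + h) + ux (x - h) (r + h) - ux x (r + 2 * h)) x ∧
      HasDerivAt (fun y => ux (y + h) (r + h) + ux (y - h) (r + h) - ux y (r + 2 * h))
        (w (x + h) (r + h) + w (x - h) (r + h) - w x (r + 2 * h)) x := by
    intro r hr hrT x h1 h2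
    have m1 : x + h ∈ Ioo 0 p := ⟨by linarith, by linarith⟩
    have m2 : x - h ∈ Ioo 0 p := ⟨by linarith, by linarith⟩
    have m3 : x ∈ Ioo 0 p := ⟨by linarith, by linarith⟩
    have n1 : r + h ∈ Ioo 0 T := ⟨by linarith, by linarith⟩
    have n2 : r + 2 * h ∈ Ioo 0 T := ⟨by linarith, by linarith⟩
    exact ⟨(((hu.hx _ m1 _ n1).comp_add_const x h).add
      ((hu.hx _ m2 _ n1).comp_sub_const x h)).sub (hu.hx _ m3 _ n2),
      (((hu.hxx _ m1 _ n1).comp_add_const x h).add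
      ((hu.hxx _ m2 _ n1).comp_sub_const x h)).sub (hu.hxx _ m3 _ n2)⟩
  have c1 := hu.continuousAt_w (x := x₀ + h) (t := 0 + h) ⟨by linarith, by linarith⟩
    ⟨by linarith, by linarith⟩
  have c2 := hu.continuousAt_w (x := x₀ - h) (t := 0 + h) ⟨by linarith, by linarith⟩
    ⟨by linarith, by linarith⟩
  have c3 := hu.continuousAt_w (x := x₀) (t := 0 + 2 * h) ⟨by linarith, by linarith⟩
    ⟨by linarith, by linarith⟩
  refine ⟨fun x => ux (x + h) (0 + h) + ux (x - h) (0 + h) - ux x (0 + 2 * h),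
    fun x => w (x + h) (0 + h) + w (x - h) (0 + h) - w x (0 + 2 * h), ?_, ?_, ?_⟩
  · exact ((c1.comp (f := fun x => (x + h, 0 + h)) (by fun_prop)).add
      (c2.comp (f := fun x => (x - h, 0 + h)) (by fun_prop))).sub
      (c3.comp (f := fun x => (x, 0 + 2 * h)) (by fun_prop))
  · filter_upwards [hev.eventually_nhds] with x hx
    obtain ⟨h1, h2⟩ := hx.self_of_nhds
    refine ⟨(hder 0 le_rfl (by linarith) x h1 h2).1.congr_of_eventuallyEq ?_,
      (hder 0 le_rfl (by linarith) x h1 h2).2⟩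
    filter_upwards [hx] with y hy using hrep y hy.1 hy.2 0 le_rfl (by linarith)
  · have hcr : ContinuousAt (fun r => w (x₀ + h) (r + h) + w (x₀ - h) (r + h)
        - w x₀ (r + 2 * h)) 0 :=
      ((c1.comp (f := fun r : ℝ => (x₀ + h, r + h)) (by fun_prop)).add
      (c2.comp (f := fun r : ℝ => (x₀ - h, r + h)) (by fun_prop))).sub
      (c3.comp (f := fun r : ℝ => (x₀, r + 2 * h)) (by fun_prop))
    refine (hcr.tendsto.mono_left nhdsWithin_le_nhds).congr' ?_
    filter_upwards [Ioo_mem_nhdsGT (show (0 : ℝ) < T - 2 * h by linarith)] with r hr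
    obtain ⟨hr0, hrT⟩ := hr
    have hm : r ∈ Ioo 0 T := ⟨hr0, by linarith⟩
    have hux : ∀ x, h < x → x < p - h →
        ux x r = ux (x + h) (r + h) + ux (x - h) (r + h) - ux x (r + 2 * h) := by
      intro x h1 h2
      refine (hu.hx x ⟨by linarith, by linarith⟩ r hm).unique
        ((hder r hr0.le (by linarith) x h1 h2).1.congr_of_eventuallyEq ?_)
      filter_upwards [lt_mem_nhds h1, gt_mem_nhds h2] with y hy1 hy2 using
        hrep y hy1 hy2 r hr0.le (by linarith)
    refine ((hu.hxx x₀ ⟨h0, hp0⟩ r hm).unique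
      ((hder r hr0.le (by linarith) x₀ hhx (by linarith)).2.congr_of_eventuallyEq ?_)).symm
    filter_upwards [hev] with y hy using hux y hy.1 hy.2

lemma tendsto_second_deriv_zero (hu : IsWave p T u ux ut w) (hp : 0 < p) (hT : 0 < T)
    (h0 : ∀ t ∈ Icc 0 T, u 0 t = 0) :
    Tendsto (deriv (deriv fun y => u y 0)) (𝓝[>] 0) (𝓝 0) := by
  obtain ⟨a, ha, hlt⟩ := exists_between (lt_min hp hT)
  obtain ⟨hap, haT⟩ := lt_min_iff.1 hlt
  have hc : 0 < min (p - a) (T - a) := lt_min (by linarith) (by linarith)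
  set c := min (p - a) (T - a)
  have hcp : c ≤ p - a := min_le_left _ _
  have hcT : c ≤ T - a := min_le_right _ _
  have hrep : ∀ x ∈ Ioo 0 c, u x 0 = u (x + a) a - u a (x + a) := by
    rintro x ⟨hx0, hxc⟩
    have := hu.charDefect_eq_zero hp hT (x := x) (t := 0) (a := a) (b := x)
      ha hx0 (by linarith) (by linarith) le_rfl (by linarith)
    simp only [charDefect] at this
    rw [show x + a - x = a by ring, show 0 + a + x = x + a by ring, sub_self, zero_add,
      zero_add, h0 x ⟨hx0.le, by linarith⟩] at this
    linarith
  have hd1 : ∀ x ∈ Ioo 0 c,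
      HasDerivAt (fun y => u (y + a) a - u a (y + a)) (ux (x + a) a - ut a (x + a)) x := by
    rintro x ⟨hx0, hxc⟩
    exact ((hu.hx _ ⟨by linarith, by linarith⟩ _ ⟨ha, haT⟩).comp_add_const x a).sub
      ((hu.ht _ ⟨ha, hap⟩ _ ⟨by linarith, by linarith⟩).comp_add_const x a)
  have hd2 : ∀ x ∈ Ioo 0 c,
      HasDerivAt (fun y => ux (y + a) a - ut a (y + a)) (w (x + a) a - w a (x + a)) x := by
    rintro x ⟨hx0, hxc⟩
    exact ((hu.hxx _ ⟨by linarith, by linarith⟩ _ ⟨ha, haT⟩).comp_add_const x a).sub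
      ((hu.htt _ ⟨ha, hap⟩ _ ⟨by linarith, by linarith⟩).comp_add_const x a)
  have e1 : ∀ x ∈ Ioo 0 c, deriv (fun y => u y 0) x = ux (x + a) a - ut a (x + a) := by
    intro x hx
    refine ((hd1 x hx).congr_of_eventuallyEq ?_).deriv
    filter_upwards [isOpen_Ioo.mem_nhds hx] with y hy using hrep y hy
  have e2 : ∀ x ∈ Ioo 0 c, deriv (deriv fun y => u y 0) x = w (x + a) a - w a (x + a) := by
    intro x hx
    refine ((hd2 x hx).congr_of_eventuallyEq ?_).deriv
    filter_upwards [isOpen_Ioo.mem_nhds hx] with y hy using e1 y hy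
  have hca := hu.continuousAt_w (x := 0 + a) (t := 0 + a) ⟨by linarith, by linarith⟩
    ⟨by linarith, by linarith⟩
  have hcont : ContinuousAt (fun x => w (x + a) (0 + a) - w (0 + a) (x + a)) 0 :=
    (hca.comp (f := fun x : ℝ => (x + a, 0 + a)) (by fun_prop)).sub
      (hca.comp (f := fun x : ℝ => (0 + a, x + a)) (by fun_prop))
  have := hcont.tendsto.mono_left (nhdsWithin_le_nhds (s := Ioi 0))
  simp only [zero_add, sub_self] at this
  refine this.congr' ?_
  filter_upwards [Ioo_mem_nhdsGT hc] with x hx using (e2 x hx).symm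

/-- The initial profile is `C²`, its second derivative extends continuously by zero to the
endpoints, and it is the trace of `u_tt`. -/
lemma exists_second_deriv (hu : IsWave p T u ux ut w) (hp : 0 < p) (hT : 0 < T)
    (h0 : ∀ t ∈ Icc 0 T, u 0 t = 0) (h1 : ∀ t ∈ Icc 0 T, u p t = 0) :
    ∃ F' g : ℝ → ℝ, ContinuousOn g (Icc 0 p) ∧ g 0 = 0 ∧ g p = 0 ∧ ∀ x ∈ Ioo 0 p,
      HasDerivAt (fun y => u y 0) (F' x) x ∧ HasDerivAt F' (g x) x ∧
      Tendsto (fun r => w x r) (𝓝[>] 0) (𝓝 (g x)) := by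
  set G := deriv (deriv fun y => u y 0) with hG
  have hloc : ∀ x ∈ Ioo 0 p, ContinuousAt G x ∧ HasDerivAt (fun y => u y 0)
      (deriv (fun y => u y 0) x) x ∧ HasDerivAt (deriv fun y => u y 0) (G x) x ∧
      Tendsto (fun r => w x r) (𝓝[>] 0) (𝓝 (G x)) := by
    intro x hx
    obtain ⟨F', F'', hc, hd, ht⟩ := hu.exists_local_second_deriv hT hx
    have e1 : deriv (fun y => u y 0) =ᶠ[𝓝 x] F' := by
      filter_upwards [hd] with y hy using hy.1.deriv
    have e2 : G =ᶠ[𝓝 x] F'' := by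
      filter_upwards [hd, e1.eventually_nhds] with y hy hy1
      exact (hy.2.congr_of_eventuallyEq hy1).deriv
    have hd' := hd.self_of_nhds
    refine ⟨hc.congr e2.symm, ?_, ?_, ?_⟩
    · rw [e1.eq_of_nhds]; exact hd'.1
    · rw [e2.eq_of_nhds]; exact hd'.2.congr_of_eventuallyEq e1
    · rw [e2.eq_of_nhds]; exact ht
  have hGc : ContinuousOn G (Ioo 0 p) := fun x hx => (hloc x hx).1.continuousWithinAt
  have hl : Tendsto G (𝓝[>] 0) (𝓝 0) := hu.tendsto_second_deriv_zero hp hT h0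
  have hr : Tendsto G (𝓝[<] p) (𝓝 0) := by
    have h2 := hu.reflect.tendsto_second_deriv_zero hp hT (fun t ht => by simpa using h1 t ht)
    have e : deriv (deriv fun y => u (p - y) 0) = fun x => G (p - x) := by
      have e1 : (deriv fun y => u (p - y) 0) = fun x => -deriv (fun y => u y 0) (p - x) := by
        funext x
        exact deriv_comp_const_sub (f := fun y => u y 0) p x
      rw [e1]
      funext x
      rw [deriv.fun_neg, deriv_comp_const_sub, neg_neg]
    rw [e] at h2
    have h3 : Tendsto (fun x => p - x) (𝓝[<] p) (𝓝[>] 0) := by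
      refine tendsto_nhdsWithin_iff.2 ⟨?_, ?_⟩
      · have : Continuous fun x => p - x := by fun_prop
        simpa using (this.tendsto p).mono_left (nhdsWithin_le_nhds (s := Iio p))
      · filter_upwards [self_mem_nhdsWithin] with x hx
        exact sub_pos.2 (mem_Iio.1 hx)
    refine (h2.comp h3).congr fun x => ?_
    simp
  have hext : ∀ x ∈ Ioo 0 p, extendFrom (Ioo 0 p) G x = G x := fun x hx =>
    extendFrom_eq (subset_closure hx) ((hGc x hx).tendsto)
  refine ⟨deriv fun y => u y 0, extendFrom (Ioo 0 p) G,
    continuousOn_Icc_extendFrom_Ioo hGc hl hr,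
    eq_lim_at_left_extendFrom_Ioo hp hl, eq_lim_at_right_extendFrom_Ioo hp hr, ?_⟩
  intro x hx
  rw [hext x hx]
  exact (hloc x hx).2

lemma hasDerivAt_diag (hu : IsWave p T u ux ut w) {y a : ℝ} (hx : y + a ∈ Ioo 0 p)
    (ht : a ∈ Ioo 0 T) :
    HasDerivAt (fun a => u (y + a) a) (ux (y + a) a + ut (y + a) a) a := by
  have hn := (isOpen_Ioo.prod isOpen_Ioo).mem_nhds (show (y + a, a) ∈ Ioo 0 p ×ˢ Ioo 0 T from
    ⟨hx, ht⟩)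
  let S : ℝ →L[ℝ] (ℝ →L[ℝ] ℝ) := ContinuousLinearMap.toSpanSingletonCLE.toContinuousLinearMap
  have key := hasStrictFDerivAt_uncurry_coprod (𝕜 := ℝ) (u := (y + a, a)) (f := u)
    (f₁ := fun x t => ContinuousLinearMap.toSpanSingleton ℝ (ux x t))
    (f₂ := fun x t => ContinuousLinearMap.toSpanSingleton ℝ (ut x t))
    (by
      filter_upwards [hn] with q hq
      exact (hu.hx q.1 hq.1 q.2 hq.2).hasFDerivAt)
    (by
      filter_upwards [hn] with q hq
      exact (hu.ht q.1 hq.1 q.2 hq.2).hasFDerivAt)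
    (S.continuous.continuousAt.comp (hu.contx.continuousAt hn))
    (S.continuous.continuousAt.comp (hu.contt.continuousAt hn))
  have hg : HasDerivAt (fun a => (y + a, a)) ((1 : ℝ), (1 : ℝ)) a :=
    ((hasDerivAt_id a).const_add y).prodMk (hasDerivAt_id a)
  have := HasFDerivAt.comp_hasDerivAt (f := fun a => (y + a, a)) a key.hasFDerivAt hg
  convert! this using 1
  simp [Function.HasUncurry.uncurry]

lemma eq_zero_of_triangle (hu : IsWave p T u ux ut w) (hp : 0 < p) (hT : 0 < T)
    (hi : ∀ x ∈ Icc 0 p, u x 0 = 0)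
    (hd : ∀ x ∈ Ioo 0 p, Tendsto (fun r => ut x r) (𝓝[>] 0) (𝓝 0))
    {y A : ℝ} (hy : 0 ≤ y) (hA : 0 ≤ A) (hyA : y + 2 * A ≤ p) (hAT : A ≤ T) :
    u (y + A) A = 0 := by
  have hbase : ∀ x ∈ Ioo 0 p, HasDerivWithinAt (fun s => u x s) 0 (Ici 0) 0 := by
    intro x hx
    refine hasDerivWithinAt_Ici_of_tendsto_deriv (s := Ioo 0 T)
      (fun t ht => (hu.ht x hx t ht).differentiableAt.differentiableWithinAt) ?_
      (Ioo_mem_nhdsGT hT) ?_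
    · have h := hu.cont (x, 0) ⟨⟨hx.1.le, hx.2.le⟩, ⟨le_rfl, hT.le⟩⟩
      exact h.comp (f := fun s : ℝ => (x, s)) (s := Ioo 0 T) (by fun_prop)
        fun s hs => ⟨⟨hx.1.le, hx.2.le⟩, ⟨hs.1.le, hs.2.le⟩⟩
    · refine (hd x hx).congr' ?_
      filter_upwards [Ioo_mem_nhdsGT hT] with t ht using (hu.ht x hx t ht).deriv.symm
  have hder : ∀ a ∈ Ioo 0 A, ux (y + a) a + ut (y + a) a = 0 := by
    rintro a ⟨ha0, haA⟩
    have hf := hu.hasDerivAt_diag (y := y) (a := a) ⟨by linarith, by linarith⟩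
      ⟨ha0, by linarith⟩
    set d := ux (y + a) a + ut (y + a) a
    set f := fun a => u (y + a) a with hfdef
    have hG : HasDerivAt (fun ε => f (a + ε) - f (a - ε)) (d + d) 0 := by
      have h1 := HasDerivAt.comp_const_add (f := f) (f' := d) a 0 (by simpa using hf)
      have h2 := HasDerivAt.comp_const_sub (f := f) (f' := d) a 0 (by simpa using hf)
      simpa using! h1.sub h2
    have hx' : y + 2 * a ∈ Ioo 0 p := ⟨by linarith, by linarith⟩
    have hH : HasDerivWithinAt (fun ε : ℝ => u (y + 2 * a) (2 * ε)) 0 (Ici 0) 0 := by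
      have h2 : HasDerivWithinAt (fun ε : ℝ => 2 * ε) 2 (Ici 0) 0 := by
        simpa using ((hasDerivAt_id (0 : ℝ)).const_mul 2).hasDerivWithinAt
      have := HasDerivWithinAt.scomp (g₁ := fun s => u (y + 2 * a) s) (h := fun ε : ℝ => 2 * ε)
        (t' := Ici 0) (s := Ici 0) (0 : ℝ) (by simpa using hbase _ hx') h2
        (fun ε hε => by simpa using hε)
      simpa using! this
    have heq : (fun ε => f (a + ε) - f (a - ε)) =ᶠ[𝓝[≥] 0] fun ε => u (y + 2 * a) (2 * ε) := by
      filter_upwards [Ico_mem_nhdsGE (show 0 < min a (A - a) from lt_min ha0 (by linarith))]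
        with ε hε
      obtain ⟨hε0, hε1⟩ := hε
      obtain ⟨hεa, hεA⟩ := lt_min_iff.1 hε1
      rcases hε0.eq_or_lt with rfl | hε0
      · simp [hi _ ⟨hx'.1.le, hx'.2.le⟩]
      have := hu.charDefect_eq_zero hp hT (x := y + 2 * a - 2 * ε) (t := 0) (a := 2 * ε)
        (b := a - ε) (by linarith) (by linarith) (by linarith) (by linarith) le_rfl (by linarith)
      simp only [charDefect] at this
      rw [hi _ ⟨by linarith, by linarith⟩] at this
      simp only [hfdef]
      rw [show y + 2 * a - 2 * ε + 2 * ε = y + 2 * a by ring,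
        show y + 2 * a - 2 * ε - (a - ε) = y + (a - ε) by ring,
        show y + 2 * a - (a - ε) = y + (a + ε) by ring,
        show 0 + 2 * ε + (a - ε) = a + ε by ring, zero_add, zero_add] at this
      linarith
    have h3 := hH.congr_of_eventuallyEq_of_mem heq (by simp)
    have h4 := (uniqueDiffOn_Ici (0 : ℝ) 0 (by simp)).eq_deriv _ hG.hasDerivWithinAt h3
    linarith
  have hcont : ContinuousOn (fun a => u (y + a) a) (Icc 0 A) := by
    refine hu.cont.comp (f := fun a : ℝ => (y + a, a)) (by fun_prop) ?_
    rintro a ⟨ha0, haA⟩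
    exact ⟨⟨by dsimp only; linarith, by dsimp only; linarith⟩, ⟨ha0, haA.trans hAT⟩⟩
  rcases hA.eq_or_lt with rfl | hA
  · exact hi _ ⟨by linarith, by linarith⟩
  obtain ⟨c, hc, hceq⟩ := exists_hasDerivAt_eq_slope (fun a => u (y + a) a)
    (fun a => ux (y + a) a + ut (y + a) a) hA hcont
    (fun a ha => hu.hasDerivAt_diag ⟨by linarith [ha.1], by linarith [ha.1, ha.2]⟩
      ⟨ha.1, by linarith [ha.2]⟩)
  rw [hder c hc, eq_comm, div_eq_zero_iff] at hceq
  rcases hceq with h | h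
  · rw [sub_eq_zero.1 h]
    exact hi _ ⟨by linarith, by linarith⟩
  · linarith

lemma eq_zero_left_first_strip (hu : IsWave p T u ux ut w) (hp : 0 < p) (hT : 0 < T)
    (h0 : ∀ t ∈ Icc 0 T, u 0 t = 0) (hi : ∀ x ∈ Icc 0 p, u x 0 = 0)
    (hd : ∀ x ∈ Ioo 0 p, Tendsto (fun r => ut x r) (𝓝[>] 0) (𝓝 0))
    {x t : ℝ} (hx : x ∈ Icc 0 (p / 2)) (ht : t ∈ Icc 0 T) (htp : t ≤ p / 2) : u x t = 0 := by
  obtain ⟨hx0, hx1⟩ := hx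
  have htri : ∀ y s, 0 ≤ s → s ≤ y → y + s ≤ p → s ≤ T → u y s = 0 := by
    intro y s h1 h2 h3 h4
    simpa using hu.eq_zero_of_triangle hp hT hi hd (y := y - s) (A := s) (by linarith) h1
      (by linarith) h4
  rcases le_or_gt t x with h | h
  · exact htri x t ht.1 h (by linarith) ht.2
  rcases hx0.eq_or_lt with rfl | hx0
  · exact h0 t ht
  have := hu.charDefect_eq_zero hp hT (x := t - x) (t := 0) (a := x) (b := t - x) hx0
    (by linarith) (by linarith) (by linarith) le_rfl (by linarith [ht.2])
  simp only [charDefect] at this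
  rw [show t - x + x = t by ring, show t - (t - x) = x by ring,
    show 0 + x + (t - x) = t by ring, zero_add, zero_add, sub_self,
    hi _ ⟨by linarith, by linarith⟩, h0 _ ⟨by linarith, by linarith [ht.2]⟩,
    htri t x hx0.le h.le (by linarith) (by linarith [ht.2])] at this
  linarith

lemma eq_zero_left_next_strip (hu : IsWave p T u ux ut w) (hp : 0 < p) (hT : 0 < T)
    (h0 : ∀ t ∈ Icc 0 T, u 0 t = 0) {t₀ : ℝ} (ht₀ : p / 2 ≤ t₀)
    (hz : ∀ x ∈ Icc 0 p, ∀ t ∈ Icc 0 T, t ≤ t₀ → u x t = 0)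
    {x t : ℝ} (hx : x ∈ Icc 0 (p / 2)) (ht : t ∈ Icc 0 T) (htp : t ≤ t₀ + p / 2) :
    u x t = 0 := by
  obtain ⟨hx0, hx1⟩ := hx
  obtain ⟨ht0, htT⟩ := ht
  rcases le_or_gt t t₀ with h | h
  · exact hz x ⟨hx0, by linarith⟩ t ⟨ht0, htT⟩ h
  rcases hx0.eq_or_lt with rfl | hx0
  · exact h0 t ⟨ht0, htT⟩
  have := hu.charDefect_eq_zero hp hT (x := t - t₀) (t := t₀ - x) (a := x) (b := t - t₀) hx0
    (by linarith) (by linarith) (by linarith) (by linarith) (by linarith)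
  simp only [charDefect] at this
  rw [show t - t₀ + x - (t - t₀) = x by ring, show t₀ - x + x + (t - t₀) = t by ring,
    sub_self, h0 _ ⟨by linarith, by linarith⟩,
    hz _ ⟨by linarith, by linarith⟩ (t₀ - x) ⟨by linarith, by linarith⟩ (by linarith),
    hz _ ⟨by linarith, by linarith⟩ (t₀ - x + x) ⟨by linarith, by linarith⟩ (by linarith)] at this
  linarith

/-- Uniqueness for the wave equation with homogeneous boundary and (pointwise) initial data. -/
lemma eq_zero (hu : IsWave p T u ux ut w) (hp : 0 < p) (hT : 0 < T)
    (h0 : ∀ t ∈ Icc 0 T, u 0 t = 0) (h1 : ∀ t ∈ Icc 0 T, u p t = 0)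
    (hi : ∀ x ∈ Icc 0 p, u x 0 = 0)
    (hd : ∀ x ∈ Ioo 0 p, Tendsto (fun r => ut x r) (𝓝[>] 0) (𝓝 0)) :
    ∀ x ∈ Icc 0 p, ∀ t ∈ Icc 0 T, u x t = 0 := by
  have hflip : ∀ x ∈ Icc 0 p, p - x ∈ Icc 0 p := fun x hx =>
    ⟨by linarith [hx.2], by linarith [hx.1]⟩
  have h1' : ∀ t ∈ Icc 0 T, u (p - 0) t = 0 := by simpa using h1
  have hstrip : ∀ n : ℕ, ∀ x ∈ Icc 0 p, ∀ t ∈ Icc 0 T, t ≤ p / 2 + n * (p / 2) → u x t = 0 := by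
    intro n
    induction n with
    | zero =>
      intro x hx t ht htn
      simp only [Nat.cast_zero, zero_mul, add_zero] at htn
      rcases le_total x (p / 2) with h | h
      · exact hu.eq_zero_left_first_strip hp hT h0 hi hd ⟨hx.1, h⟩ ht htn
      · have := hu.reflect.eq_zero_left_first_strip hp hT h1' (fun x hx => hi _ (hflip x hx))
          (fun x hx => hd _ ⟨by linarith [hx.2], by linarith [hx.1]⟩)
          (x := p - x) ⟨(hflip x hx).1, by linarith⟩ ht htn
        simpa using this
    | succ n ih =>
      intro x hx t ht htn
      have hn : p / 2 ≤ p / 2 + n * (p / 2) := by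
        have : 0 ≤ n * (p / 2) := by positivity
        linarith
      have htn' : t ≤ p / 2 + n * (p / 2) + p / 2 := by push_cast at htn; linarith
      rcases le_total x (p / 2) with h | h
      · exact hu.eq_zero_left_next_strip hp hT h0 hn ih ⟨hx.1, h⟩ ht htn'
      · have := hu.reflect.eq_zero_left_next_strip hp hT h1' hn
          (fun x hx => ih _ (hflip x hx))
          (x := p - x) ⟨(hflip x hx).1, by linarith⟩ ht htn'
        simpa using this
  intro x hx t ht
  obtain ⟨n, hn⟩ := exists_nat_ge (t / (p / 2))
  rw [div_le_iff₀ (by positivity)] at hn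
  exact hstrip n x hx t ht (by linarith)

end IsWave

lemma IsLocalMax.second_deriv_nonpos {f f' : ℝ → ℝ} {e x : ℝ} (hmax : IsLocalMax f x)
    (hf : ∀ᶠ y in 𝓝 x, HasDerivAt f (f' y) y) (hf' : HasDerivAt f' e x) : e ≤ 0 := by
  by_contra! he
  have e1 : deriv f =ᶠ[𝓝 x] f' := by filter_upwards [hf] with y hy using hy.deriv
  have hmin : IsLocalMin f x := isLocalMin_of_deriv_deriv_pos
    (by rwa [(hf'.congr_of_eventuallyEq e1).deriv]) hmax.deriv_eq_zero
    hf.self_of_nhds.continuousAt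
  have hconst : f =ᶠ[𝓝 x] fun _ => f x := by
    filter_upwards [hmax, hmin] with y h1 h2 using le_antisymm h1 h2
  have hz : f' =ᶠ[𝓝 x] fun _ => 0 := by
    filter_upwards [hf, hconst.eventually_nhds] with y h1 h2
    exact h1.unique ((hasDerivAt_const y (f x)).congr_of_eventuallyEq h2)
  exact he.ne' (hf'.unique ((hasDerivAt_const x (0 : ℝ)).congr_of_eventuallyEq hz))

lemma HasDerivAt.nonneg_of_forall_le {f : ℝ → ℝ} {d a b : ℝ} (hab : a < b)
    (hf : HasDerivAt f d b) (hle : ∀ s ∈ Ioo a b, f s ≤ f b) : 0 ≤ d := by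
  have h := (hasDerivWithinAt_iff_tendsto_slope' (s := Iio b) (by simp)).1 hf.hasDerivWithinAt
  refine ge_of_tendsto h ?_
  filter_upwards [Ioo_mem_nhdsLT hab] with s hs
  rw [slope_def_field]
  exact div_nonneg_of_nonpos (by linarith [hle s hs]) (by linarith [hs.2])

/-- Weak maximum principle for subsolutions of the heat equation. -/
lemma nonpos_of_heat_subsolution {p S : ℝ} (hS : 0 < S) {v : ℝ → ℝ → ℝ}
    (hc : ContinuousOn (fun q : ℝ × ℝ => v q.1 q.2) (Icc 0 p ×ˢ Icc 0 S))
    (hd : ∀ x ∈ Ioo 0 p, ∀ s ∈ Ioo 0 S, ∃ (d e : ℝ) (v' : ℝ → ℝ),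
      HasDerivAt (fun s => v x s) d s ∧ (∀ᶠ y in 𝓝 x, HasDerivAt (fun y => v y s) (v' y) y) ∧
      HasDerivAt v' e x ∧ d ≤ e)
    (hi : ∀ x ∈ Icc 0 p, v x 0 ≤ 0)
    (h0 : ∀ s ∈ Icc 0 S, v 0 s ≤ 0) (h1 : ∀ s ∈ Icc 0 S, v p s ≤ 0) :
    ∀ x ∈ Icc 0 p, ∀ s ∈ Icc 0 S, v x s ≤ 0 := by
  have open_top : ∀ x ∈ Icc 0 p, ∀ s ∈ Ico 0 S, v x s ≤ 0 := by
    rintro x hx s ⟨hs0, hsS⟩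
    refine le_of_forall_pos_le_add fun η hη => ?_
    rw [zero_add]
    have hε : 0 < η / S := by positivity
    set ε := η / S with hεdef
    have hsub : Icc 0 p ×ˢ Icc 0 s ⊆ Icc 0 p ×ˢ Icc 0 S :=
      prod_mono le_rfl (Icc_subset_Icc_right hsS.le)
    obtain ⟨⟨x₁, s₁⟩, ⟨hx₁, hs₁⟩, hmax⟩ := (isCompact_Icc.prod isCompact_Icc).exists_isMaxOn
      (s := Icc 0 p ×ˢ Icc 0 s) ⟨(x, s), hx, hs0, le_rfl⟩
      (f := fun q : ℝ × ℝ => v q.1 q.2 - ε * q.2) ((hc.mono hsub).sub (by fun_prop))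
    have hm : ∀ y ∈ Icc 0 p, ∀ r ∈ Icc 0 s, v y r - ε * r ≤ v x₁ s₁ - ε * s₁ := fun y hy r hr =>
      hmax (show (y, r) ∈ Icc 0 p ×ˢ Icc 0 s from ⟨hy, hr⟩)
    dsimp only at hx₁ hs₁
    have hneg : v x₁ s₁ - ε * s₁ ≤ 0 := by
      have hεs : 0 ≤ ε * s₁ := mul_nonneg hε.le hs₁.1
      rcases hs₁.1.eq_or_lt with h | hs₁0
      · have := hi x₁ hx₁
        rw [← h]
        linarith
      rcases hx₁.1.eq_or_lt with h | hx₁0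
      · have := h0 s₁ ⟨hs₁.1, hs₁.2.trans hsS.le⟩
        rw [← h]
        linarith
      rcases hx₁.2.eq_or_lt with h | hx₁p
      · have := h1 s₁ ⟨hs₁.1, hs₁.2.trans hsS.le⟩
        rw [h]
        linarith
      exfalso
      obtain ⟨d, e, v', hds, hdx, hdxx, hde⟩ :=
        hd x₁ ⟨hx₁0, hx₁p⟩ s₁ ⟨hs₁0, hs₁.2.trans_lt hsS⟩
      have he : e ≤ 0 := by
        refine IsLocalMax.second_deriv_nonpos ?_ hdx hdxx
        filter_upwards [Icc_mem_nhds hx₁0 hx₁p] with y hy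
        linarith [hm y hy s₁ hs₁]
      have hd' : 0 ≤ d - ε := by
        have hder : HasDerivAt (fun r => v x₁ r - ε * r) (d - ε) s₁ := by
          simpa using! hds.sub ((hasDerivAt_id s₁).const_mul ε)
        exact hder.nonneg_of_forall_le hs₁0
          fun r hr => hm x₁ hx₁ r ⟨hr.1.le, hr.2.le.trans hs₁.2⟩
      linarith
    have h2 := hm x hx s ⟨hs0, le_rfl⟩
    have h3 : ε * s ≤ η := by
      calc ε * s ≤ ε * S := by gcongr
        _ = η := by rw [hεdef]; field_simp
    linarith
  intro x hx s hs
  rcases hs.2.lt_or_eq with h | rfl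
  · exact open_top x hx s ⟨hs.1, h⟩
  have hcs : ContinuousOn (fun r => v x r) (Icc 0 s) :=
    hc.comp (f := fun r : ℝ => (x, r)) (by fun_prop) fun r hr => ⟨hx, hr⟩
  have hlim : Tendsto (fun r => v x r) (𝓝[Ico 0 s] s) (𝓝 (v x s)) :=
    (hcs s hs).mono Ico_subset_Icc_self
  have : (𝓝[Ico 0 s] s).NeBot := by
    rw [← mem_closure_iff_nhdsWithin_neBot, closure_Ico hS.ne]
    exact hs
  refine le_of_tendsto hlim ?_
  filter_upwards [self_mem_nhdsWithin] with r hr using open_top x hx r hr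

/-- `v` is a classical solution of `v_s = v_xx` in `(0,p) × (0,T)`, continuous up to the boundary,
with zero lateral values, first derivatives `vx`, `vs`, and second time derivative `vss`. -/
structure IsHeat (p T : ℝ) (v vx vs vss : ℝ → ℝ → ℝ) : Prop where
  cont : ContinuousOn (fun q : ℝ × ℝ => v q.1 q.2) (Icc 0 p ×ˢ Icc 0 T)
  hx : ∀ x ∈ Ioo 0 p, ∀ s ∈ Ioo 0 T, HasDerivAt (fun y => v y s) (vx x s) x
  hxx : ∀ x ∈ Ioo 0 p, ∀ s ∈ Ioo 0 T, HasDerivAt (fun y => vx y s) (vs x s) x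
  hs : ∀ x ∈ Ioo 0 p, ∀ s ∈ Ioo 0 T, HasDerivAt (fun r => v x r) (vs x s) s
  hss : ∀ x ∈ Ioo 0 p, ∀ s ∈ Ioo 0 T, HasDerivAt (fun r => vs x r) (vss x s) s
  left : ∀ s ∈ Icc 0 T, v 0 s = 0
  right : ∀ s ∈ Icc 0 T, v p s = 0

namespace IsHeat

variable {p T : ℝ} {v vx vs vss : ℝ → ℝ → ℝ}

lemma neg (hv : IsHeat p T v vx vs vss) :
    IsHeat p T (fun x s => -v x s) (fun x s => -vx x s) (fun x s => -vs x s)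
      (fun x s => -vss x s) where
  cont := hv.cont.neg
  hx x hx s hs := (hv.hx x hx s hs).neg
  hxx x hx s hs := (hv.hxx x hx s hs).neg
  hs x hx s hs := (hv.hs x hx s hs).neg
  hss x hx s hs := (hv.hss x hx s hs).neg
  left s hs := by simp [hv.left s hs]
  right s hs := by simp [hv.right s hs]

lemma eventually_hasDerivAt (hv : IsHeat p T v vx vs vss) {x s : ℝ} (hx : x ∈ Ioo 0 p)
    (hs : s ∈ Ioo 0 T) : ∀ᶠ y in 𝓝 x, HasDerivAt (fun y => v y s) (vx y s) y := by
  filter_upwards [isOpen_Ioo.mem_nhds hx] with y hy using hv.hx y hy s hs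

lemma continuousOn_initial (hv : IsHeat p T v vx vs vss) (hT : 0 < T) :
    ContinuousOn (fun x => v x 0) (Icc 0 p) :=
  hv.cont.comp (f := fun x : ℝ => (x, (0 : ℝ))) (by fun_prop) fun x hx => ⟨hx, le_rfl, hT.le⟩

lemma nonpos_of_initial_nonpos (hv : IsHeat p T v vx vs vss) (hT : 0 < T)
    (hi : ∀ x ∈ Icc 0 p, v x 0 ≤ 0) : ∀ x ∈ Icc 0 p, ∀ s ∈ Icc 0 T, v x s ≤ 0 :=
  nonpos_of_heat_subsolution hT hv.cont
    (fun x hx s hs => ⟨_, _, fun y => vx y s, hv.hs x hx s hs, hv.eventually_hasDerivAt hx hs,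
      hv.hxx x hx s hs, le_rfl⟩)
    hi (fun s hs => (hv.left s hs).le) (fun s hs => (hv.right s hs).le)

lemma eq_zero_of_initial_eq_zero (hv : IsHeat p T v vx vs vss) (hT : 0 < T)
    (hi : ∀ x ∈ Icc 0 p, v x 0 = 0) : ∀ x ∈ Icc 0 p, ∀ s ∈ Icc 0 T, v x s = 0 :=
  fun x hx s hs => le_antisymm
    (hv.nonpos_of_initial_nonpos hT (fun x hx => (hi x hx).le) x hx s hs)
    (neg_nonpos.1 (hv.neg.nonpos_of_initial_nonpos hT (fun x hx => by simp [hi x hx]) x hx s hs))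

variable {F' g : ℝ → ℝ}

lemma le_initial_add (hv : IsHeat p T v vx vs vss) (hT : 0 < T)
    (hF : ∀ x ∈ Ioo 0 p, HasDerivAt (fun y => v y 0) (F' x) x)
    (hF' : ∀ x ∈ Ioo 0 p, HasDerivAt F' (g x) x)
    {M : ℝ} (hM : 0 ≤ M) (hg : ∀ x ∈ Ioo 0 p, g x ≤ M) :
    ∀ x ∈ Icc 0 p, ∀ s ∈ Icc 0 T, v x s ≤ v x 0 + M * s := by
  have hT0 : (0 : ℝ) ∈ Icc 0 T := ⟨le_rfl, hT.le⟩
  have hinit : ContinuousOn (fun q : ℝ × ℝ => v q.1 0) (Icc 0 p ×ˢ Icc 0 T) :=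
    (hv.continuousOn_initial hT).comp continuousOn_fst fun q hq => hq.1
  have := nonpos_of_heat_subsolution hT (v := fun x s => v x s - v x 0 - M * s)
    ((hv.cont.sub hinit).sub (by fun_prop))
    (fun x hx s hs => ⟨vs x s - M, vs x s - g x, fun y => vx y s - F' y, by
      simpa using! ((hv.hs x hx s hs).sub_const (v x 0)).sub ((hasDerivAt_id s).const_mul M), by
      filter_upwards [isOpen_Ioo.mem_nhds hx] with y hy
      exact ((hv.hx y hy s hs).sub (hF y hy)).sub_const _,
      (hv.hxx x hx s hs).sub (hF' x hx), by linarith [hg x hx]⟩)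
    (by simp)
    (fun s hs => by simp [hv.left s hs, hv.left 0 hT0, mul_nonneg hM hs.1])
    (fun s hs => by simp [hv.right s hs, hv.right 0 hT0, mul_nonneg hM hs.1])
  intro x hx s hs
  linarith [this x hx s hs]

/-- A bound for the second derivative of the initial profile propagates to `v_s`. -/
lemma time_deriv_le (hv : IsHeat p T v vx vs vss)
    (hF : ∀ x ∈ Ioo 0 p, HasDerivAt (fun y => v y 0) (F' x) x)
    (hF' : ∀ x ∈ Ioo 0 p, HasDerivAt F' (g x) x)
    {M : ℝ} (hM : 0 ≤ M) (hg : ∀ x ∈ Ioo 0 p, g x ≤ M) {x s : ℝ} (hx : x ∈ Ioo 0 p)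
    (hs : s ∈ Ioo 0 T) : vs x s ≤ M := by
  have hT : 0 < T := hs.1.trans hs.2
  have incr : ∀ k, 0 < k → s + k < T → v x (s + k) - v x s ≤ M * k := by
    intro k hk hkT
    have hkT' : 0 < T - k := by linarith [hs.1]
    have hsh : ContinuousOn (fun q : ℝ × ℝ => v q.1 (q.2 + k)) (Icc 0 p ×ˢ Icc 0 (T - k)) :=
      hv.cont.comp (f := fun q : ℝ × ℝ => (q.1, q.2 + k)) (by fun_prop) fun q hq =>
        ⟨hq.1, by dsimp only; linarith [hq.2.1], by dsimp only; linarith [hq.2.2]⟩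
    have := nonpos_of_heat_subsolution hkT' (v := fun x s => v x (s + k) - v x s - M * k)
      ((hsh.sub (hv.cont.mono (prod_mono le_rfl (Icc_subset_Icc_right (by linarith))))).sub
        continuousOn_const)
      (fun x hx s hs => by
        have m1 : s ∈ Ioo 0 T := ⟨hs.1, by linarith [hs.2]⟩
        have m2 : s + k ∈ Ioo 0 T := ⟨by linarith [hs.1], by linarith [hs.2]⟩
        exact ⟨vs x (s + k) - vs x s, _, fun y => vx y (s + k) - vx y s,
          (((hv.hs x hx _ m2).comp_add_const s k).sub (hv.hs x hx s m1)).sub_const _, by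
          filter_upwards [isOpen_Ioo.mem_nhds hx] with y hy
          exact ((hv.hx y hy _ m2).sub (hv.hx y hy s m1)).sub_const _,
          (hv.hxx x hx _ m2).sub (hv.hxx x hx s m1), le_rfl⟩)
      (fun x hx => by
        have := hv.le_initial_add hT hF hF' hM hg x hx k ⟨hk.le, by linarith [hs.1]⟩
        rw [zero_add]; linarith)
      (fun r hr => by
        rw [hv.left r ⟨hr.1, by linarith [hr.2]⟩,
          hv.left (r + k) ⟨by linarith [hr.1], by linarith [hr.2]⟩]
        nlinarith)
      (fun r hr => by
        rw [hv.right r ⟨hr.1, by linarith [hr.2]⟩,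
          hv.right (r + k) ⟨by linarith [hr.1], by linarith [hr.2]⟩]
        nlinarith)
      x ⟨hx.1.le, hx.2.le⟩ s ⟨hs.1.le, by linarith⟩
    linarith
  have h := (hasDerivWithinAt_iff_tendsto_slope' (s := Ioi s) (by simp)).1
    (hv.hs x hx s hs).hasDerivWithinAt
  refine le_of_tendsto h ?_
  filter_upwards [Ioo_mem_nhdsGT hs.2] with r hr
  have := incr (r - s) (by linarith [hr.1]) (by linarith [hr.2])
  rw [add_sub_cancel] at this
  rw [slope_def_field, div_le_iff₀ (by linarith [hr.1])]
  exact this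

/-- A one-sided second-order lower bound for the growth of `v` at an initial point. -/
lemma exists_initial_add_le (hv : IsHeat p T v vx vs vss) (hT : 0 < T)
    (hF : ∀ x ∈ Ioo 0 p, HasDerivAt (fun y => v y 0) (F' x) x)
    (hF' : ∀ x ∈ Ioo 0 p, HasDerivAt F' (g x) x)
    (hgc : ContinuousOn g (Icc 0 p)) (hg0 : g 0 = 0) (hgp : g p = 0)
    {x₀ m : ℝ} (hx₀ : x₀ ∈ Ioo 0 p) (hm : m < g x₀) :
    ∃ K, 0 ≤ K ∧ ∀ s ∈ Icc 0 T, v x₀ 0 + m * s - K * s ^ 2 ≤ v x₀ s := by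
  have hT0 : (0 : ℝ) ∈ Icc 0 T := ⟨le_rfl, hT.le⟩
  have hp : 0 < p := hx₀.1.trans hx₀.2
  obtain ⟨K, hK0, hK⟩ : ∃ K, 0 ≤ K ∧ ∀ x ∈ Icc 0 p, m - K * (x - x₀) ^ 2 ≤ g x := by
    have hca := hgc.continuousAt (Icc_mem_nhds hx₀.1 hx₀.2)
    obtain ⟨δ, hδ, hδm⟩ := Metric.eventually_nhds_iff.1 (hca.eventually (lt_mem_nhds hm))
    obtain ⟨B, hB⟩ := (isCompact_Icc.image_of_continuousOn hgc).bddBelow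
    have hKn : 0 ≤ max 0 (m - B) / δ ^ 2 := by positivity
    refine ⟨max 0 (m - B) / δ ^ 2, hKn, fun x hx => ?_⟩
    rcases lt_or_ge (dist x x₀) δ with h | h
    · have h1 := hδm h
      have h2 := mul_nonneg hKn (sq_nonneg (x - x₀))
      linarith
    · have h1 : δ ^ 2 ≤ (x - x₀) ^ 2 := by
        rw [← sq_abs (x - x₀), ← Real.dist_eq]
        gcongr
      have h2 : max 0 (m - B) ≤ max 0 (m - B) / δ ^ 2 * (x - x₀) ^ 2 := by
        calc max 0 (m - B) = max 0 (m - B) / δ ^ 2 * δ ^ 2 := by field_simp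
          _ ≤ _ := by gcongr
      have h3 := hB (mem_image_of_mem g hx)
      linarith [le_max_right 0 (m - B)]
  have hinit : ContinuousOn (fun q : ℝ × ℝ => v q.1 0) (Icc 0 p ×ˢ Icc 0 T) :=
    (hv.continuousOn_initial hT).comp continuousOn_fst fun q hq => hq.1
  have side : ∀ x ∈ Icc 0 p, g x = 0 → ∀ s ∈ Icc 0 T,
      m * s - K * (x - x₀) ^ 2 * s - K * s ^ 2 ≤ 0 := by
    intro x hx hgx s hs
    have h1 := hK x hx
    rw [hgx] at h1
    nlinarith [mul_nonneg hK0 (sq_nonneg s), mul_nonneg hs.1 (sub_nonneg.2 h1)]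
  have := nonpos_of_heat_subsolution hT
    (v := fun x s => v x 0 + (m * s - K * (x - x₀) ^ 2 * s - K * s ^ 2) - v x s)
    ((hinit.add (by fun_prop)).sub hv.cont)
    (fun x hx s hs => by
      refine ⟨m - K * (x - x₀) ^ 2 - 2 * K * s - vs x s, g x - 2 * K * s - vs x s,
        fun y => F' y - 2 * K * (y - x₀) * s - vx y s, ?_, ?_, ?_, ?_⟩
      · have h1 := ((((hasDerivAt_id s).const_mul m).sub
          ((hasDerivAt_id s).const_mul (K * (x - x₀) ^ 2))).sub
          ((hasDerivAt_pow 2 s).const_mul K)).const_add (v x 0)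
        convert! h1.sub (hv.hs x hx s hs) using 1
        simp; ring
      · filter_upwards [isOpen_Ioo.mem_nhds hx] with y hy
        have h1 := ((((((hasDerivAt_id y).sub_const x₀).pow 2).const_mul K).mul_const s).const_sub
          (m * s)).sub_const (K * s ^ 2)
        convert! ((hF y hy).add h1).sub (hv.hx y hy s hs) using 1
        simp; ring
      · have h1 := (((hasDerivAt_id x).sub_const x₀).const_mul (2 * K)).mul_const s
        convert! ((hF' x hx).sub h1).sub (hv.hxx x hx s hs) using 1
        simp
      · linarith [hK x ⟨hx.1.le, hx.2.le⟩])
    (by simp)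
    (fun s hs => by
      rw [hv.left s hs, hv.left 0 hT0]
      linarith [side 0 ⟨le_rfl, hp.le⟩ hg0 s hs])
    (fun s hs => by
      rw [hv.right s hs, hv.right 0 hT0]
      linarith [side p ⟨hp.le, le_rfl⟩ hgp s hs])
    x₀ ⟨hx₀.1.le, hx₀.2.le⟩
  refine ⟨K, hK0, fun s hs => ?_⟩
  have := this s hs
  simp only [sub_self] at this
  linarith

/-- If `v_ss` has the second derivative `g` of the initial profile as trace at `s = 0`, then
`g ≤ 0`. -/
lemma second_deriv_initial_nonpos (hv : IsHeat p T v vx vs vss) (hp : 0 < p) (hT : 0 < T)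
    (hF : ∀ x ∈ Ioo 0 p, HasDerivAt (fun y => v y 0) (F' x) x)
    (hF' : ∀ x ∈ Ioo 0 p, HasDerivAt F' (g x) x)
    (hgc : ContinuousOn g (Icc 0 p)) (hg0 : g 0 = 0) (hgp : g p = 0)
    (hL : ∀ x ∈ Ioo 0 p, ∃ L, Tendsto (fun s => vs x s) (𝓝[>] 0) (𝓝 L))
    (hL' : ∀ x ∈ Ioo 0 p, Tendsto (fun s => vss x s) (𝓝[>] 0) (𝓝 (g x))) :
    ∀ x ∈ Icc 0 p, g x ≤ 0 := by
  obtain ⟨x₀, hx₀, hmax⟩ := isCompact_Icc.exists_isMaxOn ⟨0, le_rfl, hp.le⟩ hgc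
  by_contra! hpos
  obtain ⟨x₁, hx₁, hgx₁⟩ := hpos
  have hM : 0 < g x₀ := hgx₁.trans_le (hmax hx₁)
  have hx₀' : x₀ ∈ Ioo 0 p := by
    refine ⟨hx₀.1.lt_of_ne ?_, hx₀.2.lt_of_ne ?_⟩
    · rintro rfl; linarith
    · rintro rfl; linarith
  have hvs : ∀ s ∈ Ioo 0 T, vs x₀ s ≤ g x₀ := fun s hs =>
    hv.time_deriv_le hF hF' hM.le (fun x hx => hmax ⟨hx.1.le, hx.2.le⟩) hx₀' hs
  obtain ⟨L, hLim⟩ := hL x₀ hx₀'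
  have hder : HasDerivWithinAt (fun s => v x₀ s) L (Ici 0) 0 := by
    refine hasDerivWithinAt_Ici_of_tendsto_deriv (s := Ioo 0 T)
      (fun t ht => (hv.hs x₀ hx₀' t ht).differentiableAt.differentiableWithinAt) ?_
      (Ioo_mem_nhdsGT hT) ?_
    · exact (hv.cont (x₀, 0) ⟨hx₀, ⟨le_rfl, hT.le⟩⟩).comp (f := fun s : ℝ => (x₀, s))
        (s := Ioo 0 T) (by fun_prop) fun s hs => ⟨hx₀, ⟨hs.1.le, hs.2.le⟩⟩
    · refine hLim.congr' ?_
      filter_upwards [Ioo_mem_nhdsGT hT] with t ht using (hv.hs x₀ hx₀' t ht).deriv.symm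
  have hslope := (hasDerivWithinAt_iff_tendsto_slope' (s := Ioi 0) (by simp)).1
    (hder.mono Ioi_subset_Ici_self)
  have hLg : g x₀ ≤ L := by
    refine le_of_forall_lt fun m hm => ?_
    obtain ⟨m', hmm', hm'⟩ := exists_between hm
    refine hmm'.trans_le ?_
    obtain ⟨K, -, hK⟩ := hv.exists_initial_add_le hT hF hF' hgc hg0 hgp hx₀' hm'
    have hlow : Tendsto (fun s : ℝ => m' - K * s) (𝓝[>] 0) (𝓝 m') := by
      have : Continuous fun s : ℝ => m' - K * s := by fun_prop
      simpa using (this.tendsto 0).mono_left (nhdsWithin_le_nhds (s := Ioi 0))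
    refine le_of_tendsto_of_tendsto hlow hslope ?_
    filter_upwards [Ioo_mem_nhdsGT hT] with s hs
    rw [slope_def_field, sub_zero, le_div_iff₀ hs.1]
    linarith [hK s ⟨hs.1.le, hs.2.le⟩]
  obtain ⟨δ, hδ, hδpos⟩ := (mem_nhdsGT_iff_exists_Ioo_subset' (show (0 : ℝ) < T from hT)).1
    ((hL' x₀ hx₀').eventually (lt_mem_nhds hM))
  have hc : 0 < min δ T := lt_min hδ hT
  have hmono : StrictMonoOn (fun s => vs x₀ s) (Ioo 0 (min δ T)) := by
    have hm : ∀ s ∈ Ioo 0 (min δ T), s ∈ Ioo 0 T := fun s hs =>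
      ⟨hs.1, hs.2.trans_le (min_le_right _ _)⟩
    refine strictMonoOn_of_hasDerivWithinAt_pos (convex_Ioo _ _) (f' := fun s => vss x₀ s)
      (fun s hs => (hv.hss x₀ hx₀' s (hm s hs)).continuousAt.continuousWithinAt) ?_ ?_
    · rw [interior_Ioo]
      exact fun s hs => (hv.hss x₀ hx₀' s (hm s hs)).hasDerivWithinAt
    · rw [interior_Ioo]
      exact fun s hs => hδpos ⟨hs.1, hs.2.trans_le (min_le_left _ _)⟩
  set c := min δ T
  have m1 : c / 3 ∈ Ioo 0 c := ⟨by positivity, by linarith⟩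
  have m2 : c / 2 ∈ Ioo 0 c := ⟨by positivity, by linarith⟩
  have h1 : vs x₀ (c / 3) < vs x₀ (c / 2) := hmono m1 m2 (by linarith)
  have h2 := hvs (c / 2) ⟨m2.1, m2.2.trans_le (min_le_right _ _)⟩
  have h3 : L ≤ vs x₀ (c / 3) := by
    refine le_of_tendsto hLim ?_
    filter_upwards [Ioo_mem_nhdsGT m1.1] with s hs
    exact (hmono ⟨hs.1, hs.2.trans m1.2⟩ m1 hs.2).le
  linarith

lemma initial_nonneg (hv : IsHeat p T v vx vs vss) (hp : 0 < p) (hT : 0 < T)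
    (hF : ∀ x ∈ Ioo 0 p, HasDerivAt (fun y => v y 0) (F' x) x)
    (hF' : ∀ x ∈ Ioo 0 p, HasDerivAt F' (g x) x) (hg : ∀ x ∈ Icc 0 p, g x ≤ 0) :
    ∀ x ∈ Icc 0 p, 0 ≤ v x 0 := by
  have hT0 : (0 : ℝ) ∈ Icc 0 T := ⟨le_rfl, hT.le⟩
  have hconc : ConcaveOn ℝ (Icc 0 p) fun x => v x 0 := by
    refine concaveOn_of_hasDerivWithinAt2_nonpos (convex_Icc 0 p) (hv.continuousOn_initial hT)
      (f' := F') (f'' := g) ?_ ?_ ?_ <;> rw [interior_Icc]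
    · exact fun x hx => (hF x hx).hasDerivWithinAt
    · exact fun x hx => (hF' x hx).hasDerivWithinAt
    · exact fun x hx => hg x ⟨hx.1.le, hx.2.le⟩
  intro x hx
  have h := hconc.min_le_of_mem_Icc (x := 0) (y := p) ⟨le_rfl, hp.le⟩ ⟨hp.le, le_rfl⟩ hx
  simpa [hv.left 0 hT0, hv.right 0 hT0] using h

/-- Under the conjugation condition for `v_ss`, the initial profile vanishes. -/
lemma initial_eq_zero (hv : IsHeat p T v vx vs vss) (hp : 0 < p) (hT : 0 < T)
    (hF : ∀ x ∈ Ioo 0 p, HasDerivAt (fun y => v y 0) (F' x) x)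
    (hF' : ∀ x ∈ Ioo 0 p, HasDerivAt F' (g x) x)
    (hgc : ContinuousOn g (Icc 0 p)) (hg0 : g 0 = 0) (hgp : g p = 0)
    (hL : ∀ x ∈ Ioo 0 p, ∃ L, Tendsto (fun s => vs x s) (𝓝[>] 0) (𝓝 L))
    (hL' : ∀ x ∈ Ioo 0 p, Tendsto (fun s => vss x s) (𝓝[>] 0) (𝓝 (g x))) :
    ∀ x ∈ Icc 0 p, v x 0 = 0 := by
  have hFn : ∀ x ∈ Ioo 0 p, HasDerivAt (fun y => -v y 0) (-F' x) x := fun x hx => (hF x hx).neg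
  have hFn' : ∀ x ∈ Ioo 0 p, HasDerivAt (fun y => -F' y) (-g x) x := fun x hx => (hF' x hx).neg
  have h1 := hv.initial_nonneg hp hT hF hF'
    (hv.second_deriv_initial_nonpos hp hT hF hF' hgc hg0 hgp hL hL')
  have h2 := hv.neg.initial_nonneg hp hT hFn hFn'
    (hv.neg.second_deriv_initial_nonpos (g := fun x => -g x) hp hT hFn hFn' hgc.neg
      (by simp [hg0]) (by simp [hgp])
      (fun x hx => (hL x hx).imp' (fun L => -L) fun L h => h.neg) fun x hx => (hL' x hx).neg)
  exact fun x hx => le_antisymm (neg_nonneg.1 (h2 x hx)) (h1 x hx)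

end IsHeat

/-- Uniqueness (homogeneous case, Theorem 1): a solution of the mixed
parabolic-hyperbolic problem with `f ≡ 0` vanishes identically. -/
theorem stmt0 (p T : ℝ) (hp : 0 < p) (hT : 0 < T) (u : ℝ → ℝ → ℝ)
    -- continuity of `u` on the closed rectangle
    (hu_cont : ContinuousOn (fun q : ℝ × ℝ => u q.1 q.2) (Icc 0 p ×ˢ Icc (-T) T))
    -- existence of the partial derivatives u_x, u_t, u_xx, u_tt on Ω⁺ ∪ Ω⁻
    (hdiff : ∀ q : ℝ × ℝ, q ∈ (Ioo 0 p ×ˢ Ioo 0 T) ∪ (Ioo 0 p ×ˢ Ioo (-T) (0:ℝ)) →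
      DifferentiableAt ℝ (fun y => u y q.2) q.1 ∧
      DifferentiableAt ℝ (fun s => u q.1 s) q.2 ∧
      DifferentiableAt ℝ (deriv (fun y => u y q.2)) q.1 ∧
      DifferentiableAt ℝ (deriv (fun s => u q.1 s)) q.2)
    -- continuity of the partial derivatives on Ω⁺ ∪ Ω⁻
    (hux_cont : ContinuousOn (fun q : ℝ × ℝ => deriv (fun y => u y q.2) q.1)
      ((Ioo 0 p ×ˢ Ioo 0 T) ∪ (Ioo 0 p ×ˢ Ioo (-T) (0:ℝ))))
    (hut_cont : ContinuousOn (fun q : ℝ × ℝ => deriv (fun s => u q.1 s) q.2)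
      ((Ioo 0 p ×ˢ Ioo 0 T) ∪ (Ioo 0 p ×ˢ Ioo (-T) (0:ℝ))))
    (huxx_cont : ContinuousOn (fun q : ℝ × ℝ => deriv (deriv (fun y => u y q.2)) q.1)
      ((Ioo 0 p ×ˢ Ioo 0 T) ∪ (Ioo 0 p ×ˢ Ioo (-T) (0:ℝ))))
    (hutt_cont : ContinuousOn (fun q : ℝ × ℝ => deriv (deriv (fun s => u q.1 s)) q.2)
      ((Ioo 0 p ×ˢ Ioo 0 T) ∪ (Ioo 0 p ×ˢ Ioo (-T) (0:ℝ))))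
    -- (i) the homogeneous equation: u_tt = u_xx on Ω⁺, u_t = -u_xx on Ω⁻
    (hwave : ∀ x ∈ Ioo (0:ℝ) p, ∀ t ∈ Ioo (0:ℝ) T,
      deriv (deriv (fun s => u x s)) t = deriv (deriv (fun y => u y t)) x)
    (hheat : ∀ x ∈ Ioo (0:ℝ) p, ∀ t ∈ Ioo (-T) (0:ℝ),
      deriv (fun s => u x s) t = - deriv (deriv (fun y => u y t)) x)
    -- (ii) boundary conditions
    (hbc : ∀ t ∈ Ioo (-T) T, u 0 t = 0 ∧ u p t = 0)
    -- (iii) conjugation conditions: both one-sided limits exist and coincide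
    (hconj : ∀ x ∈ Ioo (0:ℝ) p,
      (∃ L : ℝ, Tendsto (fun t => u x t) (𝓝[>] 0) (𝓝 L) ∧
        Tendsto (fun t => u x t) (𝓝[<] 0) (𝓝 L)) ∧
      (∃ L : ℝ, Tendsto (fun t => deriv (fun s => u x s) t) (𝓝[>] 0) (𝓝 L) ∧
        Tendsto (fun t => deriv (fun s => u x s) t) (𝓝[<] 0) (𝓝 L)) ∧
      (∃ L : ℝ, Tendsto (fun t => deriv (deriv (fun s => u x s)) t) (𝓝[>] 0) (𝓝 L) ∧
        Tendsto (fun t => deriv (deriv (fun s => u x s)) t) (𝓝[<] 0) (𝓝 L)))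
    -- (iv) regularity conditions at the lateral boundary
    (hreg : ∀ t ∈ Ioo (-T) T, t ≠ 0 →
      Tendsto (fun x => x * deriv (fun y => u y t) x) (𝓝[>] 0) (𝓝 0) ∧
      Tendsto (fun x => (p - x) * deriv (fun y => u y t) x) (𝓝[<] p) (𝓝 0)) :
    ∀ x ∈ Icc (0:ℝ) p, ∀ t ∈ Icc (-T) T, u x t = 0 := by
  have hbc' : ∀ t ∈ Icc (-T) T, u 0 t = 0 ∧ u p t = 0 := by
    intro t ht
    have hne : (-T) ≠ T := by linarith
    have key : ∀ a ∈ Icc 0 p, (∀ s ∈ Ioo (-T) T, u a s = 0) → u a t = 0 := by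
      intro a ha h
      have hc : ContinuousOn (fun s => u a s) (Icc (-T) T) :=
        hu_cont.comp (f := fun s : ℝ => (a, s)) (by fun_prop) fun s hs => ⟨ha, hs⟩
      have h' : EqOn (fun s => u a s) (fun _ => 0) (Ioo (-T) T) := h
      exact h'.of_subset_closure hc continuousOn_const Ioo_subset_Icc_self
        (closure_Ioo hne).ge ht
    exact ⟨key 0 ⟨le_rfl, hp.le⟩ fun s hs => (hbc s hs).1,
      key p ⟨hp.le, le_rfl⟩ fun s hs => (hbc s hs).2⟩
  have hW : IsWave p T u (fun x t => deriv (fun y => u y t) x)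
      (fun x t => deriv (fun s => u x s) t) (fun x t => deriv (deriv (fun s => u x s)) t) :=
    { cont := hu_cont.mono (prod_mono_right (Icc_subset_Icc (by linarith) le_rfl))
      hx := fun x hx t ht => (hdiff (x, t) (Or.inl ⟨hx, ht⟩)).1.hasDerivAt
      hxx := fun x hx t ht => by
        rw [hwave x hx t ht]
        exact (hdiff (x, t) (Or.inl ⟨hx, ht⟩)).2.2.1.hasDerivAt
      ht := fun x hx t ht => (hdiff (x, t) (Or.inl ⟨hx, ht⟩)).2.1.hasDerivAt
      htt := fun x hx t ht => (hdiff (x, t) (Or.inl ⟨hx, ht⟩)).2.2.2.hasDerivAt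
      contx := hux_cont.mono subset_union_left
      contt := hut_cont.mono subset_union_left
      contw := hutt_cont.mono subset_union_left }
  have hneg : ∀ s ∈ Ioo 0 T, -s ∈ Ioo (-T) 0 := fun s hs =>
    ⟨by linarith [hs.2], by linarith [hs.1]⟩
  have hH : IsHeat p T (fun x s => u x (-s)) (fun x s => deriv (fun y => u y (-s)) x)
      (fun x s => -deriv (fun r => u x r) (-s)) (fun x s => deriv (deriv (fun r => u x r)) (-s)) :=
    { cont := hu_cont.comp (f := fun q : ℝ × ℝ => (q.1, -q.2)) (by fun_prop)
        fun q hq => ⟨hq.1, by linarith [hq.2.2], by linarith [hq.2.1]⟩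
      hx := fun x hx s hs => (hdiff (x, -s) (Or.inr ⟨hx, hneg s hs⟩)).1.hasDerivAt
      hxx := fun x hx s hs => by
        rw [hheat x hx (-s) (hneg s hs), neg_neg]
        exact (hdiff (x, -s) (Or.inr ⟨hx, hneg s hs⟩)).2.2.1.hasDerivAt
      hs := fun x hx s hs => by
        have h := (hdiff (x, -s) (Or.inr ⟨hx, hneg s hs⟩)).2.1.hasDerivAt
        exact (h.scomp s (hasDerivAt_neg s)).congr_deriv (by simp)
      hss := fun x hx s hs => by
        have h := (hdiff (x, -s) (Or.inr ⟨hx, hneg s hs⟩)).2.2.2.hasDerivAt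
        exact (h.scomp s (hasDerivAt_neg s)).neg.congr_deriv (by simp)
      left := fun s hs => (hbc' (-s) ⟨by linarith [hs.2], by linarith [hs.1]⟩).1
      right := fun s hs => (hbc' (-s) ⟨by linarith [hs.2], by linarith [hs.1]⟩).2 }
  have hb0 : ∀ t ∈ Icc 0 T, u 0 t = 0 := fun t ht => (hbc' t ⟨by linarith [ht.1], ht.2⟩).1
  have hbp : ∀ t ∈ Icc 0 T, u p t = 0 := fun t ht => (hbc' t ⟨by linarith [ht.1], ht.2⟩).2
  have htn : Tendsto (fun s : ℝ => -s) (𝓝[>] 0) (𝓝[<] 0) := by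
    simpa using tendsto_neg_nhdsGT (a := (0 : ℝ))
  obtain ⟨F', g, hgc, hg0, hgp, hg⟩ := hW.exists_second_deriv hp hT hb0 hbp
  have hv0 : ∀ x ∈ Icc 0 p, u x (-0) = 0 := by
    refine hH.initial_eq_zero (F' := F') (g := g) hp hT (fun x hx => ?_)
      (fun x hx => (hg x hx).2.1) hgc hg0 hgp (fun x hx => ?_) (fun x hx => ?_)
    · simpa using (hg x hx).1
    · obtain ⟨L, -, hL⟩ := (hconj x hx).2.1
      exact ⟨-L, (hL.comp htn).neg⟩
    · obtain ⟨L, hL, hL'⟩ := (hconj x hx).2.2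
      rw [tendsto_nhds_unique (hg x hx).2.2 hL]
      exact hL'.comp htn
  have hlow : ∀ x ∈ Icc 0 p, ∀ t ∈ Icc (-T) 0, u x t = 0 := by
    intro x hx t ht
    simpa using hH.eq_zero_of_initial_eq_zero hT hv0 x hx (-t)
      ⟨by linarith [ht.2], by linarith [ht.1]⟩
  have hut0 : ∀ x ∈ Ioo 0 p, Tendsto (fun t => deriv (fun s => u x s) t) (𝓝[>] 0) (𝓝 0) := by
    intro x hx
    obtain ⟨L, hL, hL'⟩ := (hconj x hx).2.1
    have h : (fun t => deriv (fun s => u x s) t) =ᶠ[𝓝[<] 0] fun _ => (0 : ℝ) := by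
      filter_upwards [Ioo_mem_nhdsLT (neg_lt_zero.2 hT)] with t ht
      have h' : (fun s => u x s) =ᶠ[𝓝 t] fun _ => (0 : ℝ) := by
        filter_upwards [Ioo_mem_nhds ht.1 ht.2] with s hs
        exact hlow x (Ioo_subset_Icc_self hx) s (Ioo_subset_Icc_self hs)
      rw [h'.deriv_eq, deriv_const]
    rwa [tendsto_nhds_unique hL' (tendsto_const_nhds.congr' h.symm)] at hL
  intro x hx t ht
  rcases le_total 0 t with h | h
  · exact hW.eq_zero hp hT hb0 hbp (fun y hy => by simpa using hv0 y hy) hut0 x hx t ⟨h, ht.2⟩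
  · exact hlow x hx t ⟨ht.1, h⟩
end

section
/- Let p, T > 0 and let u : ℝ² → ℝ be continuous on [0,p]×[0,T], with u_x, u_xx, u_t, u_tt existing and continuous on Ω⁺ = (0,p)×(0,T), satisfying u_tt = u_xx on Ω⁺, u(0,t) = u(p,t) = 0 for t ∈ (0,T), and for each t ∈ (0,T), lim_{x→0⁺} x·u_x(x,t) = 0 and lim_{x→p⁻} (p−x)·u_x(x,t) = 0. For n ≥ 1 define α_n(t) = ∫₀^p u(x,t)·X_n(x) dx. Then for each n ≥ 1, α_n is twice differentiable on (0,T) and satisfies the ordinary differential equation α_n''(t) + λ_n²·α_n(t) = 0 for all t ∈ (0,T). -/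
open Set Filter Topology intervalIntegral

/-- `λ_n = nπ/p`. -/
noncomputable def lam (p : ℝ) (n : ℕ) : ℝ := n * Real.pi / p

/-- `X_n(x) = √(2/p)·sin(λ_n x)`. -/
noncomputable def Xf (p : ℝ) (n : ℕ) (x : ℝ) : ℝ :=
  Real.sqrt (2 / p) * Real.sin (lam p n * x)

/-- Taylor's formula of order two with integral remainder. -/
lemma eq_add_integral_deriv_deriv {f : ℝ → ℝ} {a t : ℝ}
    (hf : ∀ s ∈ uIcc a t, DifferentiableAt ℝ f s)
    (hf' : ∀ s ∈ uIcc a t, DifferentiableAt ℝ (deriv f) s)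
    (hc : ContinuousOn (deriv (deriv f)) (uIcc a t)) :
    f t = f a + (t - a) * deriv f a + ∫ s in a..t, (t - s) * deriv (deriv f) s := by
  have h := integral_eq_sub_of_hasDerivAt (a := a) (b := t)
    (f := fun s => f s + (t - s) * deriv f s) (f' := fun s => (t - s) * deriv (deriv f) s)
    (fun s hs => by
      have h1 := (hf s hs).hasDerivAt
      have h2 := (hf' s hs).hasDerivAt
      have h3 := h1.add (((hasDerivAt_id s).const_sub t).mul h2)
      exact h3.congr_deriv (by simp))
    (ContinuousOn.intervalIntegrable (by fun_prop))
  rw [h]; ring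

/-- Two integrations by parts against a sine vanishing at both endpoints. -/
lemma integral_deriv_deriv_mul_sin {f : ℝ → ℝ} {c d C μ : ℝ}
    (hf : ∀ x ∈ uIcc c d, DifferentiableAt ℝ f x)
    (hf' : ∀ x ∈ uIcc c d, DifferentiableAt ℝ (deriv f) x)
    (hc : ContinuousOn (deriv (deriv f)) (uIcc c d))
    (hd : Real.sin (μ * (d - c)) = 0) :
    ∫ x in c..d, deriv (deriv f) x * (C * Real.sin (μ * (x - c))) =
      -μ ^ 2 * (∫ x in c..d, f x * (C * Real.sin (μ * (x - c)))) + C * μ * f c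
        - C * μ * Real.cos (μ * (d - c)) * f d := by
  have hfc : ContinuousOn f (uIcc c d) := fun x hx => (hf x hx).continuousAt.continuousWithinAt
  have i1 : IntervalIntegrable (fun x => deriv (deriv f) x * (C * Real.sin (μ * (x - c))))
      MeasureTheory.volume c d := ContinuousOn.intervalIntegrable (by fun_prop)
  have i2 : IntervalIntegrable (fun x => μ ^ 2 * (f x * (C * Real.sin (μ * (x - c)))))
      MeasureTheory.volume c d := ContinuousOn.intervalIntegrable (by fun_prop)
  have h := integral_eq_sub_of_hasDerivAt (a := c) (b := d)
    (f := fun x => deriv f x * (C * Real.sin (μ * (x - c)))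
      - f x * (C * (Real.cos (μ * (x - c)) * μ)))
    (f' := fun x => deriv (deriv f) x * (C * Real.sin (μ * (x - c)))
      + μ ^ 2 * (f x * (C * Real.sin (μ * (x - c)))))
    (fun x hx => by
      have h1 := (hf x hx).hasDerivAt
      have h2 := (hf' x hx).hasDerivAt
      have h0 : HasDerivAt (fun x => μ * (x - c)) μ x := by
        simpa using ((hasDerivAt_id x).sub_const c).const_mul μ
      have h3 := (h2.mul (h0.sin.const_mul C)).sub (h1.mul ((h0.cos.mul_const μ).const_mul C))
      exact h3.congr_deriv (by ring))
    (i1.add i2)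
  rw [integral_add i1 i2, integral_const_mul] at h
  simp only [hd, sub_self, mul_zero, Real.sin_zero, Real.cos_zero] at h
  linarith

lemma hasDerivAt_integral_sub_mul {β : ℝ → ℝ} (hβ : Continuous β) (a t : ℝ) :
    HasDerivAt (fun t => ∫ s in a..t, (t - s) * β s) (∫ s in a..t, β s) t := by
  have e : (fun t => ∫ s in a..t, (t - s) * β s) =
      fun t => t * (∫ s in a..t, β s) - ∫ s in a..t, s * β s := by
    funext t
    rw [← integral_const_mul, ← integral_sub]
    · simp only [sub_mul]
    · exact Continuous.intervalIntegrable (by fun_prop) _ _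
    · exact Continuous.intervalIntegrable (by fun_prop) _ _
  rw [e]
  have h1 := hβ.integral_hasStrictDerivAt a t |>.hasDerivAt
  have h2 := (show Continuous fun s => s * β s by fun_prop).integral_hasStrictDerivAt a t
    |>.hasDerivAt
  exact (((hasDerivAt_id t).mul h1).sub h2).congr_deriv (by simp)

/-- A function with an integral Taylor representation near `t` is twice differentiable there. -/
lemma hasDerivAt_deriv_of_eventuallyEq_taylor {f β : ℝ → ℝ} (hβ : Continuous β) {a c₀ c₁ t : ℝ}
    (hf : f =ᶠ[𝓝 t] fun t => c₀ + (t - a) * c₁ + ∫ s in a..t, (t - s) * β s) :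
    DifferentiableAt ℝ f t ∧ HasDerivAt (deriv f) (β t) t := by
  have h1 (r : ℝ) : HasDerivAt (fun t => c₀ + (t - a) * c₁ + ∫ s in a..t, (t - s) * β s)
      (c₁ + ∫ s in a..r, β s) r := by
    exact ((((hasDerivAt_id r).sub_const a).mul_const c₁).const_add c₀).add
      (hasDerivAt_integral_sub_mul hβ a r) |>.congr_deriv (by simp)
  refine ⟨(h1 t).differentiableAt.congr_of_eventuallyEq hf, ?_⟩
  have h2 : deriv f =ᶠ[𝓝 t] fun r => c₁ + ∫ s in a..r, β s := by
    filter_upwards [hf.eventuallyEq_nhds] with r hr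
    rw [hr.deriv_eq, (h1 r).deriv]
  exact ((hβ.integral_hasStrictDerivAt a t).hasDerivAt.const_add c₁).congr_of_eventuallyEq h2

/-- The integrated form of `u_tt = u_xx` tested against a sine vanishing at both endpoints of
`[c, d]`. -/
lemma integral_mul_sin_eq_taylor {u : ℝ → ℝ → ℝ} {c d a t C μ : ℝ} (hcd : c ≤ d) (hat : a ≤ t)
    (hdx : ∀ x ∈ Icc c d, ∀ s ∈ Icc a t, DifferentiableAt ℝ (fun y => u y s) x ∧
      DifferentiableAt ℝ (deriv (fun y => u y s)) x)
    (hdt : ∀ x ∈ Icc c d, ∀ s ∈ Icc a t, DifferentiableAt ℝ (fun r => u x r) s ∧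
      DifferentiableAt ℝ (deriv (fun r => u x r)) s)
    (hut : ContinuousOn (fun x => deriv (fun r => u x r) a) (Icc c d))
    (huxx : ContinuousOn (fun q : ℝ × ℝ => deriv (deriv (fun y => u y q.2)) q.1)
      (Icc c d ×ˢ Icc a t))
    (hwave : ∀ x ∈ Icc c d, ∀ s ∈ Icc a t,
      deriv (deriv (fun r => u x r)) s = deriv (deriv (fun y => u y s)) x)
    (hd : Real.sin (μ * (d - c)) = 0) :
    ∫ x in c..d, u x t * (C * Real.sin (μ * (x - c))) =
      (∫ x in c..d, u x a * (C * Real.sin (μ * (x - c))))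
      + (t - a) * (∫ x in c..d, deriv (fun r => u x r) a * (C * Real.sin (μ * (x - c))))
      + ∫ s in a..t, (t - s) *
        (-μ ^ 2 * (∫ x in c..d, u x s * (C * Real.sin (μ * (x - c)))) + C * μ * u c s
          - C * μ * Real.cos (μ * (d - c)) * u d s) := by
  set φ : ℝ → ℝ := fun x => C * Real.sin (μ * (x - c))
  have hφc : Continuous φ := by fun_prop
  have ha : a ∈ Icc a t := left_mem_Icc.2 hat
  have pt : ∀ x ∈ uIcc c d, u x t * φ x = u x a * φ x + (t - a) * (deriv (fun r => u x r) a * φ x)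
      + ∫ s in a..t, (t - s) * (deriv (deriv (fun y => u y s)) x * φ x) := by
    intro x hx
    rw [uIcc_of_le hcd] at hx
    have hcx : ContinuousOn (fun s => deriv (deriv (fun y => u y s)) x) (Icc a t) :=
      huxx.comp (f := fun s => (x, s)) (by fun_prop) fun s hs => ⟨hx, hs⟩
    have h := eq_add_integral_deriv_deriv (f := fun r => u x r) (a := a) (t := t)
      (by rw [uIcc_of_le hat]; exact fun s hs => (hdt x hx s hs).1)
      (by rw [uIcc_of_le hat]; exact fun s hs => (hdt x hx s hs).2)
      (by rw [uIcc_of_le hat]; exact hcx.congr fun s hs => hwave x hx s hs)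
    have e : ∫ s in a..t, (t - s) * deriv (deriv (fun r => u x r)) s =
        ∫ s in a..t, (t - s) * deriv (deriv (fun y => u y s)) x :=
      integral_congr fun s hs => by
        rw [uIcc_of_le hat] at hs
        simp only [hwave x hx s hs]
    simp only [← mul_assoc]
    rw [integral_mul_const, ← e, h]
    ring
  have hdd : ContinuousOn (fun q : ℝ × ℝ =>
      (t - q.2) * (deriv (deriv (fun y => u y q.2)) q.1 * φ q.1)) (Icc c d ×ˢ Icc a t) := by
    fun_prop
  have hint : MeasureTheory.Integrable (fun q : ℝ × ℝ =>
      (t - q.2) * (deriv (deriv (fun y => u y q.2)) q.1 * φ q.1))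
      ((MeasureTheory.volume.restrict (Ioc c d)).prod
        (MeasureTheory.volume.restrict (Ioc a t))) := by
    rw [MeasureTheory.Measure.prod_restrict]
    exact (hdd.integrableOn_compact (isCompact_Icc.prod isCompact_Icc)).mono_set
      (prod_mono Ioc_subset_Icc_self Ioc_subset_Icc_self)
  have hcont : ∀ s ∈ Icc a t, ContinuousOn (fun x => u x s) (Icc c d) := fun s hs x hx =>
    (hdx x hx s hs).1.continuousAt.continuousWithinAt
  have i1 : IntervalIntegrable (fun x => u x a * φ x) MeasureTheory.volume c d :=
    ContinuousOn.intervalIntegrable (by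
      rw [uIcc_of_le hcd]; exact (hcont a ha).mul hφc.continuousOn)
  have i2 : IntervalIntegrable (fun x => (t - a) * (deriv (fun r => u x r) a * φ x))
      MeasureTheory.volume c d :=
    ContinuousOn.intervalIntegrable (by
      rw [uIcc_of_le hcd]; exact continuousOn_const.mul (hut.mul hφc.continuousOn))
  have i3 : IntervalIntegrable
      (fun x => ∫ s in a..t, (t - s) * (deriv (deriv (fun y => u y s)) x * φ x))
      MeasureTheory.volume c d := by
    rw [intervalIntegrable_iff_integrableOn_Ioc_of_le hcd]
    simp only [integral_of_le hat]
    exact hint.integral_prod_left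
  rw [integral_congr pt, integral_add (i1.add i2) i3, integral_add i1 i2, integral_const_mul]
  congr 1
  have swap : (∫ x in c..d, ∫ s in a..t, (t - s) * (deriv (deriv (fun y => u y s)) x * φ x)) =
      ∫ s in a..t, ∫ x in c..d, (t - s) * (deriv (deriv (fun y => u y s)) x * φ x) := by
    simp only [integral_of_le hat, integral_of_le hcd]
    exact MeasureTheory.integral_integral_swap hint
  rw [swap]
  refine integral_congr fun s hs => ?_
  rw [uIcc_of_le hat] at hs
  have hcx : ContinuousOn (fun x => deriv (deriv (fun y => u y s)) x) (Icc c d) :=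
    huxx.comp (f := fun x => (x, s)) (by fun_prop) fun x hx => ⟨hx, hs⟩
  simp only [integral_const_mul]
  rw [← integral_deriv_deriv_mul_sin (f := fun y => u y s)
    (by rw [uIcc_of_le hcd]; exact fun x hx => (hdx x hx s hs).1)
    (by rw [uIcc_of_le hcd]; exact fun x hx => (hdx x hx s hs).2)
    (by rw [uIcc_of_le hcd]; exact hcx) hd]

/-- The Fourier coefficient of `u` on the shrunk interval `[ε, p - ε]`, with frequency `μ`. -/
noncomputable def shrunkCoeff (v : ℝ → ℝ → ℝ) (p C μ ε s : ℝ) : ℝ :=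
  ∫ x in ε..(p - ε), v x s * (C * Real.sin (μ * (x - ε)))

lemma continuous_shrunkCoeff {v : ℝ → ℝ → ℝ} (hv : Continuous fun q : ℝ × ℝ => v q.1 q.2)
    (p C μ ε : ℝ) : Continuous (shrunkCoeff v p C μ ε) := by
  unfold shrunkCoeff
  apply continuous_parametric_intervalIntegral_of_continuous'
  exact (hv.comp (continuous_snd.prodMk continuous_fst)).mul (by fun_prop)

lemma abs_shrunkCoeff_le {v : ℝ → ℝ → ℝ} {M : ℝ} (hM : ∀ x s, |v x s| ≤ M) {p C μ ε : ℝ}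
    (hε : 0 < ε) (hεp : ε < p / 2) (s : ℝ) : |shrunkCoeff v p C μ ε s| ≤ M * |C| * p := by
  have hM0 : 0 ≤ M := (abs_nonneg _).trans (hM 0 0)
  have h := norm_integral_le_of_norm_le_const (a := ε) (b := p - ε) (C := M * |C|)
    (f := fun x => v x s * (C * Real.sin (μ * (x - ε)))) (fun x _ => by
      rw [Real.norm_eq_abs, abs_mul, abs_mul]
      exact mul_le_mul (hM x s)
        (mul_le_of_le_one_right (abs_nonneg C) (Real.abs_sin_le_one _)) (by positivity) hM0)
  refine h.trans (mul_le_mul_of_nonneg_left ?_ (by positivity))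
  rw [abs_of_nonneg] <;> linarith

lemma tendsto_shrunkCoeff {v : ℝ → ℝ → ℝ} (hv : Continuous fun q : ℝ × ℝ => v q.1 q.2)
    {M : ℝ} (hM : ∀ x s, |v x s| ≤ M) {p : ℝ} (hp : 0 < p) (C : ℝ) {μ : ℝ → ℝ} {l : ℝ}
    (hμ : Tendsto μ (𝓝[>] 0) (𝓝 l)) (s : ℝ) :
    Tendsto (fun ε => shrunkCoeff v p C (μ ε) ε s) (𝓝[>] 0)
      (𝓝 (∫ x in (0:ℝ)..p, v x s * (C * Real.sin (l * x)))) := by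
  have hM0 : 0 ≤ M := (abs_nonneg _).trans (hM 0 0)
  have hvs : Continuous fun x => v x s := hv.comp (f := fun x => (x, s)) (by fun_prop)
  have hsmall : ∀ᶠ ε in 𝓝[>] (0:ℝ), 0 < ε ∧ ε < p / 2 :=
    Ioo_mem_nhdsGT (show (0:ℝ) < p / 2 by positivity)
  have key : Tendsto (fun ε => ∫ x in (0:ℝ)..p,
      (Ioc ε (p - ε)).indicator (fun x => v x s * (C * Real.sin (μ ε * (x - ε)))) x) (𝓝[>] 0)
      (𝓝 (∫ x in (0:ℝ)..p, v x s * (C * Real.sin (l * x)))) := by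
    refine tendsto_integral_filter_of_dominated_convergence (fun _ => M * |C|) ?_ ?_
      intervalIntegrable_const ?_
    · refine Eventually.of_forall fun ε => ?_
      have hc : Continuous fun x => v x s * (C * Real.sin (μ ε * (x - ε))) := by fun_prop
      exact (hc.measurable.indicator measurableSet_Ioc).aestronglyMeasurable
    · refine Eventually.of_forall fun ε => Eventually.of_forall fun x _ => ?_
      refine (norm_indicator_le_norm_self _ _).trans ?_
      rw [Real.norm_eq_abs, abs_mul, abs_mul]
      exact mul_le_mul (hM x s)
        (mul_le_of_le_one_right (abs_nonneg C) (Real.abs_sin_le_one _)) (by positivity) hM0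
    · filter_upwards [MeasureTheory.Measure.ae_ne MeasureTheory.volume p] with x hxp hx
      rw [uIoc_of_le hp.le] at hx
      have hx' : x < p := lt_of_le_of_ne hx.2 hxp
      have hid : Tendsto (fun ε : ℝ => ε) (𝓝[>] 0) (𝓝 0) := nhdsWithin_le_nhds
      have lim : Tendsto (fun ε => v x s * (C * Real.sin (μ ε * (x - ε)))) (𝓝[>] 0)
          (𝓝 (v x s * (C * Real.sin (l * x)))) := by
        have := hμ.mul (hid.const_sub x)
        rw [sub_zero] at this
        exact (((Real.continuous_sin.tendsto _).comp this).const_mul C).const_mul _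
      refine lim.congr' ?_
      have hpos : 0 < min x (p - x) := lt_min hx.1 (by linarith)
      filter_upwards [Ioo_mem_nhdsGT hpos] with ε hε
      have h1 := hε.2.trans_le (min_le_left _ _)
      have h2 := hε.2.trans_le (min_le_right _ _)
      rw [indicator_of_mem]
      exact ⟨h1, by linarith⟩
  refine key.congr' ?_
  filter_upwards [hsmall] with ε hε
  rw [shrunkCoeff, integral_of_le hp.le, integral_of_le (by linarith [hε.2]),
    MeasureTheory.integral_indicator measurableSet_Ioc,
    MeasureTheory.Measure.restrict_restrict measurableSet_Ioc,
    inter_eq_left.2 (Ioc_subset_Ioc hε.1.le (by linarith [hε.1]))]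

/-- The second time derivative of `shrunkCoeff`, including boundary terms. -/
noncomputable def shrunkSource (v : ℝ → ℝ → ℝ) (p C μ ε s : ℝ) : ℝ :=
  -μ ^ 2 * shrunkCoeff v p C μ ε s + C * μ * v ε s
    - C * μ * Real.cos (μ * (p - ε - ε)) * v (p - ε) s

lemma continuous_shrunkSource {v : ℝ → ℝ → ℝ} (hv : Continuous fun q : ℝ × ℝ => v q.1 q.2)
    (p C μ ε : ℝ) : Continuous (shrunkSource v p C μ ε) := by
  have h1 := continuous_shrunkCoeff hv p C μ ε
  have h2 (x : ℝ) : Continuous (v x) := hv.comp (f := fun s => (x, s)) (by fun_prop)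
  have h3 := h2 ε
  have h4 := h2 (p - ε)
  unfold shrunkSource
  fun_prop

lemma abs_shrunkSource_le {v : ℝ → ℝ → ℝ} {M : ℝ} (hM : ∀ x s, |v x s| ≤ M) {p C μ ε L : ℝ}
    (hε : 0 < ε) (hεp : ε < p / 2) (hL : |μ| ≤ L) (s : ℝ) :
    |shrunkSource v p C μ ε s| ≤ L ^ 2 * (M * |C| * p) + |C| * L * M + |C| * L * M := by
  have hM0 : 0 ≤ M := (abs_nonneg _).trans (hM 0 0)
  have hL0 : 0 ≤ L := (abs_nonneg _).trans hL
  unfold shrunkSource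
  refine (abs_sub _ _).trans (add_le_add ((abs_add_le _ _).trans (add_le_add ?_ ?_)) ?_)
  · rw [abs_mul, abs_neg, abs_pow]
    gcongr
    exact abs_shrunkCoeff_le hM hε hεp s
  · rw [abs_mul, abs_mul]
    gcongr
    exact hM _ _
  · rw [abs_mul, abs_mul, abs_mul]
    refine mul_le_mul ?_ (hM _ _) (abs_nonneg _) (by positivity)
    refine (mul_le_of_le_one_right (by positivity) (Real.abs_cos_le_one _)).trans ?_
    gcongr

lemma tendsto_shrunkSource {v : ℝ → ℝ → ℝ} (hv : Continuous fun q : ℝ × ℝ => v q.1 q.2)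
    {M : ℝ} (hM : ∀ x s, |v x s| ≤ M) {p : ℝ} (hp : 0 < p) (C : ℝ) {μ : ℝ → ℝ} {l : ℝ}
    (hμ : Tendsto μ (𝓝[>] 0) (𝓝 l)) {s : ℝ} (h0 : v 0 s = 0) (h1 : v p s = 0) :
    Tendsto (fun ε => shrunkSource v p C (μ ε) ε s) (𝓝[>] 0)
      (𝓝 (-l ^ 2 * ∫ x in (0:ℝ)..p, v x s * (C * Real.sin (l * x)))) := by
  have hvs : Continuous fun x => v x s := hv.comp (f := fun x => (x, s)) (by fun_prop)
  have hid : Tendsto (fun ε : ℝ => ε) (𝓝[>] 0) (𝓝 0) := nhdsWithin_le_nhds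
  have hp' : Tendsto (fun ε : ℝ => p - ε) (𝓝[>] 0) (𝓝 p) := by simpa using hid.const_sub p
  have l1 := (hvs.tendsto 0).comp hid
  have l2 := (hvs.tendsto p).comp hp'
  have l3 := (Real.continuous_cos.tendsto _).comp (hμ.mul (hp'.sub hid))
  have := (((hμ.pow 2).neg.mul (tendsto_shrunkCoeff hv hM hp C hμ s)).add
    ((hμ.const_mul C).mul l1)).sub (((hμ.const_mul C).mul l3).mul l2)
  simpa [h0, h1, shrunkSource] using this

lemma tendsto_integral_sub_mul_shrunkSource {v : ℝ → ℝ → ℝ}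
    (hv : Continuous fun q : ℝ × ℝ => v q.1 q.2)
    {M : ℝ} (hM : ∀ x s, |v x s| ≤ M) {p : ℝ} (hp : 0 < p) (C : ℝ) {μ : ℝ → ℝ} {l : ℝ}
    (hμ : Tendsto μ (𝓝[>] 0) (𝓝 l)) {a r : ℝ} (har : a ≤ r)
    (hbc : ∀ s ∈ Icc a r, v 0 s = 0 ∧ v p s = 0) :
    Tendsto (fun ε => ∫ s in a..r, (r - s) * shrunkSource v p C (μ ε) ε s) (𝓝[>] 0)
      (𝓝 (∫ s in a..r, (r - s) *
        (-l ^ 2 * ∫ x in (0:ℝ)..p, v x s * (C * Real.sin (l * x))))) := by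
  have hsmall : ∀ᶠ ε in 𝓝[>] (0:ℝ), 0 < ε ∧ ε < p / 2 :=
    Ioo_mem_nhdsGT (show (0:ℝ) < p / 2 by positivity)
  have hL : ∀ᶠ ε in 𝓝[>] (0:ℝ), |μ ε| ≤ |l| + 1 := hμ.abs.eventually_le_const (by linarith)
  set K := (|l| + 1) ^ 2 * (M * |C| * p) + |C| * (|l| + 1) * M + |C| * (|l| + 1) * M
  refine tendsto_integral_filter_of_dominated_convergence (fun _ => (r - a) * K) ?_ ?_
    intervalIntegrable_const ?_
  · refine Eventually.of_forall fun ε => Continuous.aestronglyMeasurable ?_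
    exact (continuous_const.sub continuous_id).mul (continuous_shrunkSource hv p C (μ ε) ε)
  · filter_upwards [hsmall, hL] with ε hε hLε
    refine Eventually.of_forall fun s hs => ?_
    rw [uIoc_of_le har] at hs
    rw [Real.norm_eq_abs, abs_mul, abs_of_nonneg (sub_nonneg.2 hs.2)]
    exact mul_le_mul (by linarith [hs.1]) (abs_shrunkSource_le hM hε.1 hε.2 hLε s)
      (abs_nonneg _) (by linarith)
  · refine Eventually.of_forall fun s hs => ?_
    rw [uIoc_of_le har] at hs
    have h := hbc s (Ioc_subset_Icc_self hs)
    exact (tendsto_shrunkSource hv hM hp C hμ h.1 h.2).const_mul _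

lemma exists_continuous_bounded_extension {u : ℝ → ℝ → ℝ} {p T : ℝ} (hp : 0 ≤ p) (hT : 0 ≤ T)
    (hu : ContinuousOn (fun q : ℝ × ℝ => u q.1 q.2) (Icc 0 p ×ˢ Icc 0 T)) :
    ∃ v : ℝ → ℝ → ℝ, Continuous (fun q : ℝ × ℝ => v q.1 q.2) ∧ ∃ M, (∀ x s, |v x s| ≤ M) ∧
      ∀ x ∈ Icc 0 p, ∀ s ∈ Icc 0 T, v x s = u x s := by
  obtain ⟨M, hM⟩ := (isCompact_Icc.prod isCompact_Icc).exists_bound_of_continuousOn hu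
  refine ⟨fun x s => u (projIcc 0 p hp x) (projIcc 0 T hT s), ?_, M, fun x s =>
    hM (projIcc 0 p hp x, projIcc 0 T hT s) ⟨Subtype.coe_prop _, Subtype.coe_prop _⟩, ?_⟩
  · refine hu.comp_continuous
      (f := fun q : ℝ × ℝ => ((projIcc 0 p hp q.1 : ℝ), (projIcc 0 T hT q.2 : ℝ))) ?_
      fun q => ⟨Subtype.coe_prop _, Subtype.coe_prop _⟩
    exact (continuous_subtype_val.comp (continuous_projIcc.comp continuous_fst)).prodMk
      (continuous_subtype_val.comp (continuous_projIcc.comp continuous_snd))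
  · intro x hx s hs
    simp only [projIcc_of_mem hp hx, projIcc_of_mem hT hs]

/-- The Fourier coefficients `α_n(t) = ∫₀^p u(x,t) X_n(x) dx` of a solution of the
wave equation `u_tt = u_xx` on `Ω⁺ = (0,p)×(0,T)` satisfy `α_n'' + λ_n² α_n = 0`. -/
theorem stmt2 (p T : ℝ) (hp : 0 < p) (hT : 0 < T) (u : ℝ → ℝ → ℝ)
    -- continuity of `u` on the closed rectangle `[0,p] × [0,T]`
    (hu_cont : ContinuousOn (fun q : ℝ × ℝ => u q.1 q.2) (Icc 0 p ×ˢ Icc 0 T))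
    -- existence of the partial derivatives u_x, u_t, u_xx, u_tt on Ω⁺
    (hdiff : ∀ q : ℝ × ℝ, q ∈ Ioo 0 p ×ˢ Ioo (0:ℝ) T →
      DifferentiableAt ℝ (fun y => u y q.2) q.1 ∧
      DifferentiableAt ℝ (fun s => u q.1 s) q.2 ∧
      DifferentiableAt ℝ (deriv (fun y => u y q.2)) q.1 ∧
      DifferentiableAt ℝ (deriv (fun s => u q.1 s)) q.2)
    -- continuity of the partial derivatives on Ω⁺
    (hux_cont : ContinuousOn (fun q : ℝ × ℝ => deriv (fun y => u y q.2) q.1)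
      (Ioo 0 p ×ˢ Ioo (0:ℝ) T))
    (hut_cont : ContinuousOn (fun q : ℝ × ℝ => deriv (fun s => u q.1 s) q.2)
      (Ioo 0 p ×ˢ Ioo (0:ℝ) T))
    (huxx_cont : ContinuousOn (fun q : ℝ × ℝ => deriv (deriv (fun y => u y q.2)) q.1)
      (Ioo 0 p ×ˢ Ioo (0:ℝ) T))
    (hutt_cont : ContinuousOn (fun q : ℝ × ℝ => deriv (deriv (fun s => u q.1 s)) q.2)
      (Ioo 0 p ×ˢ Ioo (0:ℝ) T))
    -- the wave equation `u_tt = u_xx` on Ω⁺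
    (hwave : ∀ x ∈ Ioo (0:ℝ) p, ∀ t ∈ Ioo (0:ℝ) T,
      deriv (deriv (fun s => u x s)) t = deriv (deriv (fun y => u y t)) x)
    -- boundary conditions
    (hbc : ∀ t ∈ Ioo (0:ℝ) T, u 0 t = 0 ∧ u p t = 0)
    -- regularity conditions at the lateral boundary
    (hreg : ∀ t ∈ Ioo (0:ℝ) T,
      Tendsto (fun x => x * deriv (fun y => u y t) x) (𝓝[>] 0) (𝓝 0) ∧
      Tendsto (fun x => (p - x) * deriv (fun y => u y t) x) (𝓝[<] p) (𝓝 0)) :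
    ∀ n : ℕ, 1 ≤ n → ∀ t ∈ Ioo (0:ℝ) T,
      DifferentiableAt ℝ (fun s => ∫ x in (0:ℝ)..p, u x s * Xf p n x) t ∧
      DifferentiableAt ℝ (deriv (fun s => ∫ x in (0:ℝ)..p, u x s * Xf p n x)) t ∧
      deriv (deriv (fun s => ∫ x in (0:ℝ)..p, u x s * Xf p n x)) t
        + (lam p n) ^ 2 * (∫ x in (0:ℝ)..p, u x t * Xf p n x) = 0 := by
  intro n _ t ht
  obtain ⟨v, hv, M, hM, hvu⟩ := exists_continuous_bounded_extension hp.le hT.le hu_cont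
  set C := Real.sqrt (2 / p) with hC
  set l := lam p n with hl
  set μ : ℝ → ℝ := fun ε => n * Real.pi / (p - 2 * ε) with hμd
  have hμ : Tendsto μ (𝓝[>] 0) (𝓝 l) := by
    have : ContinuousAt μ 0 := by
      refine ContinuousAt.div (by fun_prop) (by fun_prop) ?_
      simpa using hp.ne'
    have h := this.tendsto.mono_left (nhdsWithin_le_nhds (s := Ioi 0))
    simpa [hμd, hl, lam] using h
  set a := t / 2 with ha
  set b := (t + T) / 2 with hb
  have ha0 : 0 < a := by linarith [ht.1]
  have hat : a < t := by linarith [ht.1]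
  have htb : t < b := by linarith [ht.2]
  have hbT : b < T := by linarith [ht.2]
  have hsmall : ∀ᶠ ε in 𝓝[>] (0:ℝ), 0 < ε ∧ ε < p / 2 :=
    Ioo_mem_nhdsGT (show (0:ℝ) < p / 2 by positivity)
  have hα : ∀ s ∈ Icc 0 T, (∫ x in (0:ℝ)..p, u x s * Xf p n x) =
      ∫ x in (0:ℝ)..p, v x s * (C * Real.sin (l * x)) := by
    intro s hs
    refine integral_congr fun x hx => ?_
    rw [uIcc_of_le hp.le] at hx
    simp only [hvu x hx s hs, Xf, hC, hl]
  have hαc : Continuous fun s => ∫ x in (0:ℝ)..p, v x s * (C * Real.sin (l * x)) := by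
    apply continuous_parametric_intervalIntegral_of_continuous'
    exact (hv.comp (continuous_snd.prodMk continuous_fst)).mul (by fun_prop)
  have hβ : Continuous fun s => -l ^ 2 * ∫ x in (0:ℝ)..p, v x s * (C * Real.sin (l * x)) := by
    fun_prop
  have taylor : ∀ ε, 0 < ε → ε < p / 2 → ∀ r ∈ Icc a b,
      shrunkCoeff v p C (μ ε) ε r = shrunkCoeff v p C (μ ε) ε a
        + (r - a) * (∫ x in ε..(p - ε),
          deriv (fun r => u x r) a * (C * Real.sin (μ ε * (x - ε))))
        + ∫ s in a..r, (r - s) * shrunkSource v p C (μ ε) ε s := by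
    intro ε hε hεp r hr
    have hx : ∀ x ∈ Icc ε (p - ε), x ∈ Ioo 0 p := fun x hx =>
      ⟨hε.trans_le hx.1, hx.2.trans_lt (by linarith)⟩
    have hs : ∀ s ∈ Icc a r, s ∈ Ioo 0 T := fun s hs =>
      ⟨ha0.trans_le hs.1, (hs.2.trans hr.2).trans_lt hbT⟩
    have hle : ε ≤ p - ε := by linarith
    have haT : a ∈ Ioo 0 T := hs a (left_mem_Icc.2 hr.1)
    have hA : ∀ s ∈ Icc a r, (∫ x in ε..(p - ε), u x s * (C * Real.sin (μ ε * (x - ε)))) =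
        shrunkCoeff v p C (μ ε) ε s := fun s hs' =>
      integral_congr fun x hx' => by
        rw [uIcc_of_le hle] at hx'
        simp only [hvu x (Ioo_subset_Icc_self (hx x hx')) s (Ioo_subset_Icc_self (hs s hs'))]
    have h := integral_mul_sin_eq_taylor (u := u) (C := C) (μ := μ ε) hle hr.1
      (fun x hx' s hs' => ⟨(hdiff (x, s) ⟨hx x hx', hs s hs'⟩).1,
        (hdiff (x, s) ⟨hx x hx', hs s hs'⟩).2.2.1⟩)
      (fun x hx' s hs' => ⟨(hdiff (x, s) ⟨hx x hx', hs s hs'⟩).2.1,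
        (hdiff (x, s) ⟨hx x hx', hs s hs'⟩).2.2.2⟩)
      (hut_cont.comp (f := fun x => (x, a)) (by fun_prop) fun x hx' => ⟨hx x hx', haT⟩)
      (huxx_cont.mono (prod_mono hx hs))
      (fun x hx' s hs' => hwave x (hx x hx') s (hs s hs'))
      (by
        have : μ ε * (p - ε - ε) = n * Real.pi := by
          have : p - 2 * ε ≠ 0 := by linarith
          simp only [hμd]
          field_simp
          ring
        rw [this, Real.sin_nat_mul_pi])
    rw [hA r (right_mem_Icc.2 hr.1), hA a (left_mem_Icc.2 hr.1)] at h
    rw [h]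
    congr 1
    refine integral_congr fun s hs' => ?_
    rw [uIcc_of_le hr.1] at hs'
    have hsT := Ioo_subset_Icc_self (hs s hs')
    simp only [hA s hs', shrunkSource, hvu ε ⟨hε.le, by linarith⟩ s hsT,
      hvu (p - ε) ⟨by linarith, by linarith⟩ s hsT]
  have limI : ∀ r ∈ Icc a b,
      Tendsto (fun ε => ∫ s in a..r, (r - s) * shrunkSource v p C (μ ε) ε s) (𝓝[>] 0)
      (𝓝 (∫ s in a..r, (r - s) *
        (-l ^ 2 * ∫ x in (0:ℝ)..p, v x s * (C * Real.sin (l * x))))) := by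
    intro r hr
    refine tendsto_integral_sub_mul_shrunkSource hv hM hp C hμ hr.1 fun s hs => ?_
    have hs' : s ∈ Ioo 0 T := ⟨ha0.trans_le hs.1, (hs.2.trans hr.2).trans_lt hbT⟩
    have hsT := Ioo_subset_Icc_self hs'
    rw [hvu 0 ⟨le_rfl, hp.le⟩ s hsT, hvu p ⟨hp.le, le_rfl⟩ s hsT]
    exact hbc s hs'
  have limA := tendsto_shrunkCoeff hv hM hp C hμ
  have hbm : b ∈ Icc a b := right_mem_Icc.2 (hat.trans htb).le
  have hba : b - a ≠ 0 := by linarith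
  obtain ⟨c₁, hc₁⟩ : ∃ c₁, Tendsto (fun ε => ∫ x in ε..(p - ε),
      deriv (fun r => u x r) a * (C * Real.sin (μ ε * (x - ε)))) (𝓝[>] 0) (𝓝 c₁) := by
    refine ⟨_, ((((limA b).sub (limA a)).sub (limI b hbm)).div_const (b - a)).congr' ?_⟩
    filter_upwards [hsmall] with ε hε
    rw [taylor ε hε.1 hε.2 b hbm, add_sub_right_comm, add_sub_cancel_left, add_sub_cancel_right,
      mul_div_cancel_left₀ _ hba]
  have rep : ∀ r ∈ Icc a b, (∫ x in (0:ℝ)..p, v x r * (C * Real.sin (l * x))) =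
      (∫ x in (0:ℝ)..p, v x a * (C * Real.sin (l * x))) + (r - a) * c₁ +
      ∫ s in a..r, (r - s) *
        (-l ^ 2 * ∫ x in (0:ℝ)..p, v x s * (C * Real.sin (l * x))) := by
    intro r hr
    refine tendsto_nhds_unique (limA r)
      ((((limA a).add (hc₁.const_mul (r - a))).add (limI r hr)).congr' ?_)
    filter_upwards [hsmall] with ε hε
    exact (taylor ε hε.1 hε.2 r hr).symm
  obtain ⟨h1, h2⟩ := hasDerivAt_deriv_of_eventuallyEq_taylor hβ
    (f := fun s => ∫ x in (0:ℝ)..p, u x s * Xf p n x) (t := t) (by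
      filter_upwards [Ioo_mem_nhds hat htb] with r hr
      rw [hα r ⟨(ha0.trans hr.1).le, (hr.2.trans hbT).le⟩]
      exact rep r (Ioo_subset_Icc_self hr))
  refine ⟨h1, h2.differentiableAt, ?_⟩
  rw [h2.deriv, hα t (Ioo_subset_Icc_self ht)]
  ring
end
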